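/- Let n ≥ 2 and let A(s), B(s) ∈ F[s]^{n×n} be regular pencils with homogeneous invariant factors φ₁ | ⋯ | φ_n and ψ₁ | ⋯ | ψ_n. Suppose there exists λ₀ ∈ F ∪ {∞} such that the partial multiplicities at λ₀ coincide: m_i(λ₀, A(s)) = m_i(λ₀, B(s)) for all 1 ≤ i ≤ n. Let 0 ≤ r ≤ n. Then there exists a pencil P(s) with normal rank exactly r and A(s) + P(s) strictly equivalent to B(s) if and only if φ_{i−r}(s,t) | ψ_i(s,t) | φ_{i+r}(s,t) for all 1 ≤ i ≤ n. -/

import Mathlib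

/-- A polynomial matrix is a (matrix) pencil if every entry has degree at most 1. -/
def IsPencil {F : Type*} [Field F] {m n : ℕ} (M : Matrix (Fin m) (Fin n) (Polynomial F)) : Prop :=
  ∀ i j, (M i j).degree ≤ 1

/-- Normal rank of a polynomial matrix: its rank over the field of rational functions. -/
noncomputable def normalRank {F : Type*} [Field F] {m n : ℕ}
    (M : Matrix (Fin m) (Fin n) (Polynomial F)) : ℕ :=
  (M.map (algebraMap (Polynomial F) (RatFunc F))).rank

/-- Strict equivalence of polynomial matrices (pencils):
`G = Q * H * R` for invertible constant matrices `Q`, `R`. -/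
def StrictEquiv {F : Type*} [Field F] {m n : ℕ}
    (G H : Matrix (Fin m) (Fin n) (Polynomial F)) : Prop :=
  ∃ (Q : Matrix (Fin m) (Fin m) F) (R : Matrix (Fin n) (Fin n) F),
    IsUnit Q.det ∧ IsUnit R.det ∧ G = (Q.map Polynomial.C) * H * (R.map Polynomial.C)

/-- The pencil `G₀ + s G₁` as a polynomial matrix. -/
noncomputable def pencilOf {F : Type*} [Field F] {m n : ℕ}
    (G₀ G₁ : Matrix (Fin m) (Fin n) F) : Matrix (Fin m) (Fin n) (Polynomial F) :=
  G₀.map Polynomial.C + (Polynomial.X : Polynomial F) • G₁.map Polynomial.C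

/-- The homogeneous pencil `t G₀ + s G₁` (variables `s = X 0`, `t = X 1`). -/
noncomputable def homPencil {F : Type*} [Field F] {m n : ℕ}
    (G₀ G₁ : Matrix (Fin m) (Fin n) F) : Matrix (Fin m) (Fin n) (MvPolynomial (Fin 2) F) :=
  (MvPolynomial.X 1 : MvPolynomial (Fin 2) F) • G₀.map MvPolynomial.C +
    (MvPolynomial.X 0 : MvPolynomial (Fin 2) F) • G₁.map MvPolynomial.C

/-- The set of `k × k` minors of a matrix. -/
def minorsSet {R : Type*} [CommRing R] {m n : ℕ} (M : Matrix (Fin m) (Fin n) R) (k : ℕ) :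
    Set R :=
  { d | ∃ (ri : Fin k → Fin m) (ci : Fin k → Fin n),
      Function.Injective ri ∧ Function.Injective ci ∧ d = (M.submatrix ri ci).det }

/-- `g` is a greatest common divisor of the set `S`. -/
def IsGCDOf {R : Type*} [CommRing R] (g : R) (S : Set R) : Prop :=
  (∀ x ∈ S, g ∣ x) ∧ ∀ d : R, (∀ x ∈ S, d ∣ x) → d ∣ g

/-- `φ 0, …, φ (n-1)` are homogeneous invariant factors (up to units) of the pencil
`G₀ + s G₁`: for each `k ≤ n` the product of the first `k` of them is a gcd of the
`k × k` minors of the homogeneous pencil `t G₀ + s G₁`. -/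
def IsHomogeneousIF {F : Type*} [Field F] {n : ℕ} (G₀ G₁ : Matrix (Fin n) (Fin n) F)
    (φ : ℕ → MvPolynomial (Fin 2) F) : Prop :=
  ∀ k : ℕ, k ≤ n → IsGCDOf (∏ i ∈ Finset.range k, φ i) (minorsSet (homPencil G₀ G₁) k)

/-- Extension of a finite family of invariant factors (indexed `1, …, n`, stored with
offset `1` so that `φ 0` is the first one) to all integer indices, with the convention
that it is `1` below the range and `0` above it. -/
def extIF {R : Type*} [CommRing R] (n : ℕ) (φ : ℕ → R) : ℤ → R :=
  fun j => if j < 1 then 1 else if (n : ℤ) < j then 0 else φ (j - 1).toNat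

/-- Interlacing condition `φ_{i-r} ∣ ψ_i ∣ φ_{i+r}`, `1 ≤ i ≤ n`. -/
def Interlace {R : Type*} [CommRing R] (n r : ℕ) (φ ψ : ℕ → R) : Prop :=
  ∀ i : ℕ, 1 ≤ i → i ≤ n →
    extIF n φ ((i : ℤ) - r) ∣ extIF n ψ (i : ℤ) ∧
      extIF n ψ (i : ℤ) ∣ extIF n φ ((i : ℤ) + r)

/-- The operation `P_X` on pencils, acting on the pair `(G₀, G₁)` of coefficients of
`G(s) = G₀ + s G₁`: for `X = [[x, y], [z, w]]`,
`P_X(s G₁ + G₀) = s (x G₁ + z G₀) + (y G₁ + w G₀)`. -/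
def mapP {F : Type*} [Field F] {m n : ℕ} (X : Matrix (Fin 2) (Fin 2) F)
    (G : Matrix (Fin m) (Fin n) F × Matrix (Fin m) (Fin n) F) :
    Matrix (Fin m) (Fin n) F × Matrix (Fin m) (Fin n) F :=
  (X 0 1 • G.2 + X 1 1 • G.1, X 0 0 • G.2 + X 1 0 • G.1)

/-- The substitution `Π_X(Φ)(s, t) = Φ(s x + t y, s z + t w)` for `X = [[x, y], [z, w]]`. -/
noncomputable def PiX {F : Type*} [Field F] (X : Matrix (Fin 2) (Fin 2) F)
    (Φ : MvPolynomial (Fin 2) F) : MvPolynomial (Fin 2) F :=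
  MvPolynomial.aeval
    ![MvPolynomial.C (X 0 0) * MvPolynomial.X 0 + MvPolynomial.C (X 0 1) * MvPolynomial.X 1,
      MvPolynomial.C (X 1 0) * MvPolynomial.X 0 + MvPolynomial.C (X 1 1) * MvPolynomial.X 1] Φ

/-- The homogeneous invariant factor of a nonzero `1 × 1` pencil `a(s) = a₀ + s a₁`:
the homogenization `t a₀ + s a₁`, made monic with respect to `s`
(equal to `t` when `a₁ = 0`). -/
noncomputable def homIF1 {F : Type*} [Field F] (a : Polynomial F) : MvPolynomial (Fin 2) F :=
  MvPolynomial.C (a.leadingCoeff)⁻¹ *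
    (MvPolynomial.C (a.coeff 1) * MvPolynomial.X 0 + MvPolynomial.C (a.coeff 0) * MvPolynomial.X 1)

/-- The homogeneous pencil associated to a polynomial matrix pencil. -/
noncomputable def homOf {F : Type*} [Field F] {n : ℕ}
    (M : Matrix (Fin n) (Fin n) (Polynomial F)) : Matrix (Fin n) (Fin n) (MvPolynomial (Fin 2) F) :=
  homPencil (M.map fun p => p.coeff 0) (M.map fun p => p.coeff 1)

section

open Module

theorem finrank_range_add_finrank_ker_of_isDomain {D M N : Type*} [CommRing D] [IsDomain D]
    [AddCommGroup M] [AddCommGroup N] [Module D M] [Module D N] [Module.Finite D M]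
    (f : M →ₗ[D] N) :
    finrank D (LinearMap.range f) + finrank D (LinearMap.ker f) = finrank D M := by
  rw [← (LinearMap.ker f).finrank_quotient_add_finrank, f.quotKerEquivRange.finrank_eq]

theorem finrank_ker_of_apply_eq_one {D M : Type*} [CommRing D] [IsDomain D]
    [AddCommGroup M] [Module D M] [Module.Finite D M]
    {w : M →ₗ[D] D} {v : M} (h : w v = 1) {n : ℕ} (hM : finrank D M = n + 1) :
    finrank D (LinearMap.ker w) = n := by
  have h1 : LinearMap.range w = ⊤ := LinearMap.range_eq_top.2 fun d => ⟨d • v, by simp [h]⟩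
  have h2 := finrank_range_add_finrank_ker_of_isDomain w
  rw [h1, finrank_top, finrank_self, hM] at h2
  omega

theorem exists_smith_basis {D : Type*} [CommRing D] [IsDomain D] [IsPrincipalIdealRing D] (n : ℕ) :
    ∀ {M N : Type*} [AddCommGroup M] [AddCommGroup N] [Module D M] [Module D N]
      [Module.Free D M] [Module.Free D N] [Module.Finite D M] [Module.Finite D N]
      (_ : finrank D M = n) (_ : finrank D N = n) (f : M →ₗ[D] N),
      ∃ (b : Basis (Fin n) D M) (c : Basis (Fin n) D N) (d : Fin n → D),
        (∀ i, f (b i) = d i • c i) ∧ ∀ i j, i ≤ j → d i ∣ d j := by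
  induction n with
  | zero =>
    intro M N _ _ _ _ _ _ _ _ hM hN f
    exact ⟨finBasisOfFinrankEq D M hM, finBasisOfFinrankEq D N hN, fun _ => 0,
      fun i => i.elim0, fun i => i.elim0⟩
  | succ n ih =>
    intro M N _ _ _ _ _ _ _ _ hM hN f
    by_cases hf : f = 0
    · subst hf
      exact ⟨finBasisOfFinrankEq D M hM, finBasisOfFinrankEq D N hN, fun _ => 0,
        fun i => by simp, fun i j _ => dvd_rfl⟩
    obtain ⟨I, ⟨u, v, rfl⟩, hmax⟩ := (wellFounded_gt (α := Ideal D)).has_min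
      {I | ∃ (u : N →ₗ[D] D) (v : M), I = Ideal.span {u (f v)}}
      ⟨_, 0, 0, rfl⟩
    have key : ∀ b, (∀ x z, ∃ (u' : N →ₗ[D] D) (v' : M), u' (f v') = x * u (f v) + z * b) →
        u (f v) ∣ b := by
      intro b hb
      obtain ⟨g, hg⟩ := IsPrincipalIdealRing.principal (Ideal.span {u (f v), b})
      rw [Ideal.submodule_span_eq] at hg
      have hgm : g ∈ Ideal.span {u (f v), b} := hg ▸ Ideal.mem_span_singleton_self g
      obtain ⟨x, z, hxz⟩ := Ideal.mem_span_pair.1 hgm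
      obtain ⟨u', v', h⟩ := hb x z
      have h1 : u (f v) ∈ Ideal.span {g} := hg ▸ Ideal.subset_span (by simp)
      have h2 : b ∈ Ideal.span {g} := hg ▸ Ideal.subset_span (by simp)
      have h3 := hmax (Ideal.span {g}) ⟨u', v', by rw [h, hxz]⟩
      have h4 : Ideal.span {u (f v)} ≤ Ideal.span {g} := by
        rwa [Ideal.span_singleton_le_iff_mem]
      have h5 : Ideal.span {u (f v)} = Ideal.span {g} := by
        by_contra hne
        exact h3 (lt_of_le_of_ne h4 hne)
      rw [← h5] at h2
      exact Ideal.mem_span_singleton.1 h2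
    set a := u (f v) with ha
    let bM := finBasisOfFinrankEq D M hM
    let bN := finBasisOfFinrankEq D N hN
    have ha0 : a ≠ 0 := by
      intro h0
      apply hf
      refine bM.ext fun i => bN.ext_elem fun j => ?_
      have := hmax (Ideal.span {bN.coord j (f (bM i))}) ⟨_, _, rfl⟩
      rw [h0] at this
      by_contra hne
      apply this
      rw [show Ideal.span {(0 : D)} = ⊥ by simp]
      rw [bot_lt_iff_ne_bot, Ne, Ideal.span_singleton_eq_bot]
      simpa using hne
    have c1 : ∀ u' : N →ₗ[D] D, a ∣ u' (f v) := fun u' =>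
      key _ fun x z => ⟨x • u + z • u', v, by simp [ha]⟩
    have c2 : ∀ v', a ∣ u (f v') := fun v' =>
      key _ fun x z => ⟨u, x • v + z • v', by simp [ha]⟩
    have c3 : ∀ (u' : N →ₗ[D] D) v', u' (f v) = 0 → u (f v') = 0 → a ∣ u' (f v') :=
      fun u' v' h h' => key _ fun x z => ⟨x • u + z • u', v + v', by simp [ha, h, h']⟩
    choose q hq using fun j => c1 (bN.coord j)
    choose p hp using fun i => c2 (bM i)
    let y : N := ∑ j, q j • bN j
    let w : M →ₗ[D] D := bM.constr D p
    have hy : f v = a • y := by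
      rw [← bN.sum_repr (f v), Finset.smul_sum]
      refine Finset.sum_congr rfl fun j _ => ?_
      rw [smul_smul, ← hq j]; simp
    have hw : ∀ x, u (f x) = a * w x := by
      intro x
      have : u ∘ₗ f = a • w := bM.ext fun i => by
        simp only [LinearMap.comp_apply, LinearMap.smul_apply, w, Basis.constr_basis, smul_eq_mul]
        exact hp i
      exact LinearMap.congr_fun this x
    have uy : u y = 1 := by
      apply mul_left_cancel₀ ha0
      rw [mul_one, ← smul_eq_mul, ← map_smul, ← hy]
    have wv : w v = 1 := by
      apply mul_left_cancel₀ ha0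
      rw [mul_one, ← hw]
    have hfr : ∀ x ∈ LinearMap.ker w, f x ∈ LinearMap.ker u := by
      intro x hx
      rw [LinearMap.mem_ker] at hx ⊢
      rw [hw, hx, mul_zero]
    obtain ⟨b, c, d, hd, hch⟩ := ih (finrank_ker_of_apply_eq_one wv hM)
      (finrank_ker_of_apply_eq_one uy hN) (f.restrict hfr)
    have hd' : ∀ i, f (b i) = d i • (c i : N) := fun i => by
      have := congrArg Subtype.val (hd i)
      simpa using this
    have had : ∀ i, a ∣ d i := by
      intro i
      let pr : N →ₗ[D] LinearMap.ker u :=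
        LinearMap.codRestrict _ (LinearMap.id - (LinearMap.toSpanSingleton D N y) ∘ₗ u)
          (fun x => by simp [uy])
      have hpr : ∀ x : LinearMap.ker u, pr x = x := fun x => by
        apply Subtype.ext
        have := x.2
        rw [LinearMap.mem_ker] at this
        simp [pr, this]
      have hpy : pr y = 0 := by
        apply Subtype.ext
        simp [pr, uy]
      have := c3 (c.coord i ∘ₗ pr) (b i) (by simp [hy, hpy]) (by
        have := (b i).2
        rw [LinearMap.mem_ker] at this
        rw [hw, this, mul_zero])
      rw [hd'] at this
      simpa [hpr] using this
    refine ⟨Basis.mkFinCons v b ?_ ?_, Basis.mkFinCons y c ?_ ?_, Fin.cons a d, ?_, ?_⟩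
    · intro r x hx h
      have := congrArg w h
      simpa [wv, LinearMap.mem_ker.1 hx] using this
    · intro z
      exact ⟨-w z, by simp [wv]⟩
    · intro r x hx h
      have := congrArg u h
      simpa [uy, LinearMap.mem_ker.1 hx] using this
    · intro z
      exact ⟨-u z, by simp [uy]⟩
    · intro i
      refine Fin.cases ?_ (fun i => ?_) i
      · simp [hy]
      · simp [hd']
    · intro i j
      refine Fin.cases ?_ (fun i => ?_) i
      · intro _
        refine Fin.cases ?_ (fun j => ?_) j
        · simp
        · simpa using had j
      · refine Fin.cases ?_ (fun j => ?_) j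
        · intro h; exact absurd h (by simp)
        · intro h; simpa using hch i j (by simpa using h)

theorem dvd_minors_mul_left {R : Type*} [CommRing R] {l m n k : ℕ} {p : R}
    {M : Matrix (Fin m) (Fin n) R} (h : ∀ x ∈ minorsSet M k, p ∣ x)
    (U : Matrix (Fin l) (Fin m) R) : ∀ x ∈ minorsSet (U * M) k, p ∣ x := by
  rintro _ ⟨ri, ci, -, hci, rfl⟩
  have h1 : ((U * M).submatrix ri ci).det =
      Matrix.detRowAlternating.toMultilinearMap
        (fun i => ∑ a, U (ri i) a • fun j => M a (ci j)) := by
    change Matrix.det _ = Matrix.det _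
    congr 1
    ext i j
    simp [Matrix.mul_apply]
  rw [h1, MultilinearMap.map_sum]
  refine Finset.dvd_sum fun r _ => ?_
  rw [MultilinearMap.map_smul_univ]
  refine Dvd.dvd.mul_left ?_ _
  by_cases hr : Function.Injective r
  · exact h _ ⟨r, ci, hr, hci, rfl⟩
  · simp only [Function.Injective, not_forall] at hr
    obtain ⟨i, j, hij, hne⟩ := hr
    rw [AlternatingMap.coe_multilinearMap,
      AlternatingMap.map_eq_zero_of_eq _ _ (by simp only [hij]) hne]
    exact dvd_zero _

theorem mem_minorsSet_transpose {R : Type*} [CommRing R] {m n k : ℕ}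
    {M : Matrix (Fin m) (Fin n) R} {x : R} : x ∈ minorsSet M.transpose k ↔ x ∈ minorsSet M k := by
  constructor
  · rintro ⟨ri, ci, hri, hci, rfl⟩
    exact ⟨ci, ri, hci, hri, by rw [← Matrix.det_transpose]; rfl⟩
  · rintro ⟨ri, ci, hri, hci, rfl⟩
    exact ⟨ci, ri, hci, hri, by rw [← Matrix.det_transpose]; rfl⟩

theorem dvd_minors_mul_right {R : Type*} [CommRing R] {l m n k : ℕ} {p : R}
    {M : Matrix (Fin m) (Fin n) R} (h : ∀ x ∈ minorsSet M k, p ∣ x)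
    (V : Matrix (Fin n) (Fin l) R) : ∀ x ∈ minorsSet (M * V) k, p ∣ x := by
  intro x hx
  rw [← mem_minorsSet_transpose, Matrix.transpose_mul] at hx
  exact dvd_minors_mul_left (fun y hy => h y (mem_minorsSet_transpose.1 hy)) _ x hx

theorem prod_range_dvd_prod_of_card_eq {R : Type*} [CommMonoid R] {δ : ℕ → R}
    (hδ : ∀ i j, i ≤ j → δ i ∣ δ j) (k : ℕ) :
    ∀ S : Finset ℕ, S.card = k → ∏ i ∈ Finset.range k, δ i ∣ ∏ i ∈ S, δ i := by
  induction k with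
  | zero => intro S _; simp
  | succ k ih =>
    intro S hS
    have hne : S.Nonempty := Finset.card_pos.1 (by omega)
    have hm := S.max'_mem hne
    rw [Finset.prod_range_succ, ← Finset.prod_erase_mul S δ hm]
    refine mul_dvd_mul (ih _ (by rw [Finset.card_erase_of_mem hm]; omega)) (hδ _ _ ?_)
    have : S ⊆ Finset.range (S.max' hne + 1) := fun x hx => by
      have := S.le_max' x hx
      simp; omega
    have := Finset.card_le_card this
    simp at this
    omega

theorem isGCDOf_minorsSet_diagonal {R : Type*} [CommRing R] {n k : ℕ} (hk : k ≤ n) {δ : ℕ → R}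
    (hδ : ∀ i j, i ≤ j → δ i ∣ δ j) :
    IsGCDOf (∏ i ∈ Finset.range k, δ i)
      (minorsSet (Matrix.diagonal fun i : Fin n => δ i) k) := by
  constructor
  · rintro _ ⟨ri, ci, hri, hci, rfl⟩
    rw [Matrix.det_apply]
    refine Finset.dvd_sum fun σ _ => ?_
    refine (?_ : _ ∣ _).trans (dvd_of_eq (Units.smul_def _ _).symm)
    rw [zsmul_eq_mul]
    refine Dvd.dvd.mul_left ?_ _
    by_cases hall : ∀ i, ri (σ i) = ci i
    · have h1 : ∏ i, (Matrix.diagonal fun i : Fin n => δ i).submatrix ri ci (σ i) i =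
          ∏ i ∈ (Finset.univ : Finset (Fin k)).image (fun i => (ci i : ℕ)), δ i := by
        rw [Finset.prod_image (fun x _ y _ h => hci (Fin.ext h))]
        refine Finset.prod_congr rfl fun i _ => ?_
        simp [hall i]
      rw [h1]
      apply prod_range_dvd_prod_of_card_eq hδ
      rw [Finset.card_image_of_injective _ (fun x y h => hci (Fin.ext h))]
      simp
    · push Not at hall
      obtain ⟨i, hi⟩ := hall
      rw [Finset.prod_eq_zero (Finset.mem_univ i) (by simp [hi])]
      exact dvd_zero _
  · intro d hd
    refine hd _ ⟨Fin.castLE hk, Fin.castLE hk, Fin.castLE_injective hk, Fin.castLE_injective hk, ?_⟩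
    rw [show (Matrix.diagonal fun i : Fin n => δ i).submatrix (Fin.castLE hk) (Fin.castLE hk) =
      Matrix.diagonal fun i : Fin k => δ i from by
        exact Matrix.submatrix_diagonal _ _ (Fin.castLE_injective hk)]
    rw [Matrix.det_diagonal, Finset.prod_range]

theorem IsGCDOf.associated {R : Type*} [CommRing R] [IsDomain R] {g h : R} {S : Set R}
    (hg : IsGCDOf g S) (hh : IsGCDOf h S) : Associated g h :=
  associated_of_dvd_dvd (hh.2 g hg.1) (hg.2 h hh.1)

theorem det_mem_minorsSet {R : Type*} [CommRing R] {n : ℕ} (M : Matrix (Fin n) (Fin n) R) :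
    M.det ∈ minorsSet M n :=
  ⟨id, id, Function.injective_id, Function.injective_id, by simp⟩

theorem associated_of_isGCDOf_minorsSet {D : Type*} [CommRing D] [IsDomain D]
    {n : ℕ} {M : Matrix (Fin n) (Fin n) D}
    (hM : M.det ≠ 0) {α δ : ℕ → D}
    (hα : ∀ k ≤ n, IsGCDOf (∏ i ∈ Finset.range k, α i) (minorsSet M k))
    (hδ : ∀ k ≤ n, IsGCDOf (∏ i ∈ Finset.range k, δ i) (minorsSet M k)) :
    ∀ i < n, Associated (α i) (δ i) := by
  intro i hi
  have h0 : ∏ i ∈ Finset.range n, α i ≠ 0 := fun h => hM <| by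
    have := (hα n le_rfl).1 _ (det_mem_minorsSet M)
    rwa [h, zero_dvd_iff] at this
  have h1 : ∏ i ∈ Finset.range i, α i ≠ 0 := by
    rw [Finset.prod_ne_zero_iff] at h0 ⊢
    exact fun j hj => h0 j (by simp at hj ⊢; omega)
  have e1 := (hα i hi.le).associated (hδ i hi.le)
  have e2 := (hα (i + 1) hi).associated (hδ (i + 1) hi)
  rw [Finset.prod_range_succ, Finset.prod_range_succ] at e2
  exact e2.of_mul_left e1 h1

theorem exists_smith_basis_of_isGCDOf {D : Type*} [CommRing D] [IsDomain D]
    [IsPrincipalIdealRing D] {n : ℕ} {M : Matrix (Fin n) (Fin n) D} (hM : M.det ≠ 0) {α : ℕ → D}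
    (hα : ∀ k ≤ n, IsGCDOf (∏ i ∈ Finset.range k, α i) (minorsSet M k)) :
    ∃ b c : Basis (Fin n) D (Fin n → D), ∀ i, M.mulVec (b i) = α i • c i := by
  obtain ⟨b, c, d, hd, hch⟩ := exists_smith_basis n (by simp) (by simp) M.mulVecLin
  simp only [Matrix.mulVecLin_apply] at hd
  let δ : ℕ → D := fun i => if h : i < n then d ⟨i, h⟩ else 0
  have hδ : ∀ i j, i ≤ j → δ i ∣ δ j := by
    intro i j hij
    by_cases hj : j < n
    · simp only [δ, hj, hij.trans_lt hj, dif_pos]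
      exact hch _ _ hij
    · simp [δ, hj]
  have hδd : ∀ i : Fin n, δ i = d i := fun i => by simp [δ]
  let e := Pi.basisFun D (Fin n)
  have h1 : M * e.toMatrix b = e.toMatrix c * Matrix.diagonal (fun i : Fin n => δ i) := by
    ext i j
    have := congrFun (hd j) i
    rw [Matrix.mul_diagonal, hδd]
    simpa [Matrix.mul_apply, Matrix.mulVec, dotProduct, e, Basis.toMatrix_apply, mul_comm] using
      this
  have hb := e.toMatrix_mul_toMatrix_flip b
  have hc := c.toMatrix_mul_toMatrix_flip e
  have h2 : M = e.toMatrix c * Matrix.diagonal (fun i : Fin n => δ i) * b.toMatrix e := by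
    rw [← h1, Matrix.mul_assoc, hb, Matrix.mul_one]
  have h3 : Matrix.diagonal (fun i : Fin n => δ i) = c.toMatrix e * (M * e.toMatrix b) := by
    rw [h1, ← Matrix.mul_assoc, hc, Matrix.one_mul]
  have h4 : ∀ k ≤ n, IsGCDOf (∏ i ∈ Finset.range k, δ i) (minorsSet M k) := by
    intro k hk
    have hg := isGCDOf_minorsSet_diagonal hk hδ
    constructor
    · rw [h2]
      exact dvd_minors_mul_right (dvd_minors_mul_left hg.1 _) _
    · intro x hx
      apply hg.2
      rw [h3]
      exact dvd_minors_mul_left (dvd_minors_mul_right hx _) _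
  have h5 := associated_of_isGCDOf_minorsSet hM h4 hα
  choose u hu using fun i : Fin n => h5 i i.2
  refine ⟨b, c.unitsSMul fun i => (u i)⁻¹, fun i => ?_⟩
  rw [hd, Basis.unitsSMul_apply, ← hu i, Units.smul_def, smul_smul, hδd, Units.mul_inv_cancel_right]

/-- Vectors whose `i`-th entry is divisible by `a i`. -/
def dvdSubmodule {D ι : Type*} [CommRing D] (a : ι → D) : Submodule D (ι → D) where
  carrier := {w | ∀ i, a i ∣ w i}
  add_mem' h h' i := dvd_add (h i) (h' i)
  zero_mem' _ := dvd_zero _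
  smul_mem' c _ h i := (h i).mul_left c

theorem mem_dvdSubmodule {D ι : Type*} [CommRing D] {a w : ι → D} :
    w ∈ dvdSubmodule a ↔ ∀ i, a i ∣ w i := Iff.rfl

/-- The module `⨁ D / (a i)`. -/
abbrev TorsionModule {D ι : Type*} [CommRing D] (a : ι → D) : Type _ :=
  (ι → D) ⧸ dvdSubmodule a

theorem exists_presentation_of_isGCDOf {D : Type*} [CommRing D] [IsDomain D]
    [IsPrincipalIdealRing D] {n : ℕ} {M : Matrix (Fin n) (Fin n) D} (hM : M.det ≠ 0) {α : ℕ → D}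
    (hα : ∀ k ≤ n, IsGCDOf (∏ i ∈ Finset.range k, α i) (minorsSet M k)) :
    ∃ q : (Fin n → D) →ₗ[D] TorsionModule (fun i : Fin n => α i),
      Function.Surjective q ∧ ∀ v, q v = 0 ↔ ∃ x, v = M.mulVec x := by
  obtain ⟨b, c, h⟩ := exists_smith_basis_of_isGCDOf hM hα
  let q : (Fin n → D) →ₗ[D] TorsionModule (fun i : Fin n => α i) :=
    (dvdSubmodule (fun i : Fin n => α i)).mkQ ∘ₗ (c.equivFun : (Fin n → D) →ₗ[D] (Fin n → D))
  refine ⟨q, ?_, fun v => ?_⟩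
  · rw [LinearMap.coe_comp]
    exact (Submodule.mkQ_surjective _).comp c.equivFun.surjective
  · rw [LinearMap.comp_apply, ← LinearMap.mem_ker, Submodule.ker_mkQ, mem_dvdSubmodule]
    constructor
    · intro hv
      choose y hy using hv
      refine ⟨∑ i, y i • b i, ?_⟩
      rw [← Matrix.mulVecLin_apply, map_sum, ← c.sum_equivFun v]
      refine Finset.sum_congr rfl fun i _ => ?_
      rw [map_smul, Matrix.mulVecLin_apply, h, smul_smul, mul_comm, ← hy]
      rfl
    · rintro ⟨x, rfl⟩ i
      rw [← b.sum_repr x, ← Matrix.mulVecLin_apply, map_sum]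
      simp [h, Finsupp.single_apply]

end

section

open Module Polynomial

/-- The commutator `x ↦ T (X • x) - X • T x` of a linear map with multiplication by `X`. -/
noncomputable def commX {F M N : Type*} [Field F] [AddCommGroup M] [AddCommGroup N] [Module F M]
    [Module F[X] M] [IsScalarTower F F[X] M] [Module F N] [Module F[X] N] [IsScalarTower F F[X] N]
    (T : M →ₗ[F] N) : M →ₗ[F] N :=
  T ∘ₗ Algebra.lsmul F F M (X : F[X]) - Algebra.lsmul F F N (X : F[X]) ∘ₗ T

section
variable {F M N P : Type*} [Field F] [AddCommGroup M] [AddCommGroup N] [Module F M]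
  [Module F[X] M] [IsScalarTower F F[X] M] [Module F N] [Module F[X] N] [IsScalarTower F F[X] N]
  [AddCommGroup P] [Module F P] [Module F[X] P] [IsScalarTower F F[X] P]

theorem commX_apply (T : M →ₗ[F] N) (x : M) :
    commX T x = T ((X : F[X]) • x) - (X : F[X]) • T x := rfl

theorem commX_comp (S : N →ₗ[F] P) (T : M →ₗ[F] N) :
    commX (S ∘ₗ T) = S ∘ₗ commX T + commX S ∘ₗ T := by
  refine LinearMap.ext fun x => ?_
  simp [commX_apply]

theorem commX_symm (T : M ≃ₗ[F] N) :
    commX (T.symm : N →ₗ[F] M) = -(T.symm : N →ₗ[F] M) ∘ₗ commX (T : M →ₗ[F] N) ∘ₗ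
      (T.symm : N →ₗ[F] M) := by
  refine LinearMap.ext fun x => ?_
  simp [commX_apply]
end

section
universe u
variable {F : Type*} {M N P : Type u} [Field F] [AddCommGroup M] [AddCommGroup N] [Module F M]
  [Module F[X] M] [IsScalarTower F F[X] M] [Module F N] [Module F[X] N] [IsScalarTower F F[X] N]
  [AddCommGroup P] [Module F P] [Module F[X] P] [IsScalarTower F F[X] P]

theorem rank_commX_symm_le (T : M ≃ₗ[F] N) :
    (commX (T.symm : N →ₗ[F] M)).rank ≤ (commX (T : M →ₗ[F] N)).rank := by
  rw [commX_symm]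
  exact (LinearMap.rank_comp_le_right (commX (T : M →ₗ[F] N) ∘ₗ (T.symm : N →ₗ[F] M))
    (-(T.symm : N →ₗ[F] M))).trans
    (LinearMap.rank_comp_le_left _ _)

theorem rank_commX_comp_le (S : N →ₗ[F] P) (T : M →ₗ[F] N) :
    (commX (S ∘ₗ T)).rank ≤ (commX T).rank + (commX S).rank := by
  rw [commX_comp]
  exact (LinearMap.rank_add_le _ _).trans
    (add_le_add (LinearMap.rank_comp_le_right _ _) (LinearMap.rank_comp_le_left _ _))
end

/-- Two torsion modules are identified by an `F`-linear bijection which commutes with `X`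
up to rank `r`. -/
def RankSimilar {F : Type*} [Field F] {n : ℕ} (r : ℕ) (a b : Fin n → F[X]) : Prop :=
  ∃ T : TorsionModule a ≃ₗ[F] TorsionModule b,
    (commX (T : TorsionModule a →ₗ[F] TorsionModule b)).rank ≤ r

theorem RankSimilar.symm {F : Type*} [Field F] {n r : ℕ} {a b : Fin n → F[X]}
    (h : RankSimilar r a b) : RankSimilar r b a := by
  unfold RankSimilar at h ⊢
  obtain ⟨T, hT⟩ := h
  exact Exists.intro T.symm ((rank_commX_symm_le T).trans hT)

theorem RankSimilar.trans {F : Type*} [Field F] {n r s : ℕ} {a b c : Fin n → F[X]}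
    (h : RankSimilar r a b) (h' : RankSimilar s b c) : RankSimilar (r + s) a c := by
  unfold RankSimilar at h h' ⊢
  obtain ⟨T, hT⟩ := h
  obtain ⟨S, hS⟩ := h'
  have h1 := rank_commX_comp_le (S : TorsionModule b →ₗ[F] TorsionModule c)
    (T : TorsionModule a →ₗ[F] TorsionModule b)
  refine Exists.intro (T.trans S) (h1.trans ?_)
  rw [Nat.cast_add]
  exact add_le_add hT hS

theorem rankSimilar_zero_of_associated {F : Type*} [Field F] {n : ℕ} {a b : Fin n → F[X]}
    (h : ∀ i, Associated (a i) (b i)) : RankSimilar 0 a b := by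
  have hab : dvdSubmodule a = dvdSubmodule b := by
    ext w
    rw [mem_dvdSubmodule, mem_dvdSubmodule]
    exact forall_congr' fun i => (h i).dvd_iff_dvd_left
  let T : TorsionModule a ≃ₗ[F[X]] TorsionModule b := Submodule.quotEquivOfEq _ _ hab
  refine ⟨T.restrictScalars F, ?_⟩
  have : commX ((T.restrictScalars F : _ ≃ₗ[F] _) :
      TorsionModule a →ₗ[F] TorsionModule b) = 0 := by
    refine LinearMap.ext fun x => ?_
    rw [commX_apply]
    exact sub_eq_zero.2 (T.map_smul X x)
  rw [this, LinearMap.rank_zero]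
  simp

theorem dvdSubmodule_eq_pi {D ι : Type*} [CommRing D] (a : ι → D) :
    dvdSubmodule a = Submodule.pi Set.univ fun i => Ideal.span {a i} := by
  ext w
  simp [mem_dvdSubmodule, Submodule.mem_pi, Ideal.mem_span_singleton]

/-- The torsion module as a product. -/
noncomputable def torsionModuleEquivPi {D ι : Type*} [CommRing D] [Fintype ι] [DecidableEq ι]
    (a : ι → D) : TorsionModule a ≃ₗ[D] ((i : ι) → D ⧸ Ideal.span {a i}) :=
  (Submodule.quotEquivOfEq _ _ (dvdSubmodule_eq_pi a)).trans (Submodule.quotientPi _)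

theorem finite_torsionModule {F : Type*} [Field F] {n : ℕ} {a : Fin n → F[X]}
    (ha : ∀ i, a i ≠ 0) : Module.Finite F (TorsionModule a) := by
  have : ∀ i, Module.Finite F (F[X] ⧸ Ideal.span {a i}) := fun i =>
    (AdjoinRoot.powerBasis (ha i)).finite
  exact Module.Finite.equiv ((torsionModuleEquivPi a).restrictScalars F).symm

theorem finrank_torsionModule {F : Type*} [Field F] {n : ℕ} {a : Fin n → F[X]}
    (ha : ∀ i, a i ≠ 0) : finrank F (TorsionModule a) = ∑ i, (a i).natDegree := by
  have : ∀ i, Module.Finite F (F[X] ⧸ Ideal.span {a i}) := fun i =>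
    (AdjoinRoot.powerBasis (ha i)).finite
  rw [((torsionModuleEquivPi a).restrictScalars F).finrank_eq, finrank_pi_fintype]
  exact Finset.sum_congr rfl fun i _ => finrank_quotient_span_eq_natDegree

theorem exists_linearMap_torsionModule_surjective {F : Type*} [Field F] {N : ℕ}
    {a : Fin (N + 1) → F[X]} {c : Fin N → F[X]} (ha : ∀ i, a i ≠ 0) (hc : ∀ i, c i ≠ 0)
    (h1 : ∀ i, a i.castSucc ∣ c i) (h2 : ∀ i, c i ∣ a i.succ) {e : ℕ}
    (he : ∑ i, (a i).natDegree = e + ∑ i, (c i).natDegree) :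
    ∃ f : (F[X] × TorsionModule c) →ₗ[F[X]] TorsionModule a,
      ∀ z, ∃ (ρ : F[X]) (w : TorsionModule c), ρ ∈ degreeLT F e ∧ f (ρ, w) = z := by
  choose p hp using h2
  let x : Fin (N + 1) → TorsionModule a := fun i => (dvdSubmodule a).mkQ (Pi.single i 1)
  have hx : ∀ i d, a i ∣ d → d • x i = 0 := by
    intro i d hd
    rw [← map_smul, ← LinearMap.mem_ker, Submodule.ker_mkQ, mem_dvdSubmodule]
    intro j
    by_cases hij : j = i
    · subst hij
      simpa using hd
    · simp [hij]
  have hx' : ∀ i, c i • (x i.castSucc - p i • x i.succ) = 0 := fun i => by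
    rw [smul_sub, hx _ _ (h1 i), smul_smul, ← hp, hx _ _ dvd_rfl, sub_zero]
  let l' : TorsionModule c →ₗ[F[X]] TorsionModule a := (dvdSubmodule c).liftQ
    (Fintype.linearCombination F[X] fun i => x i.castSucc - p i • x i.succ) (by
      intro w hw
      rw [LinearMap.mem_ker, Fintype.linearCombination_apply]
      refine Finset.sum_eq_zero fun i _ => ?_
      obtain ⟨d, hd⟩ := mem_dvdSubmodule.1 hw i
      rw [hd, mul_comm, mul_smul, hx', smul_zero])
  let f : (F[X] × TorsionModule c) →ₗ[F[X]] TorsionModule a :=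
    LinearMap.coprod (LinearMap.toSpanSingleton F[X] _ (x (Fin.last N))) l'
  have hf : ∀ ρ w, f (ρ, w) = ρ • x (Fin.last N) + l' w := fun ρ w => by simp [f]
  have hl : ∀ i, x i.castSucc - p i • x i.succ ∈ LinearMap.range l' := by
    intro i
    refine ⟨(dvdSubmodule c).mkQ (Pi.single i 1), ?_⟩
    rw [Submodule.mkQ_apply, Submodule.liftQ_apply]
    simp
  have hall : ∀ i, x i ∈ LinearMap.range f := by
    have hle : LinearMap.range l' ≤ LinearMap.range f := by
      rintro _ ⟨w, rfl⟩
      exact ⟨(0, w), by simp [hf]⟩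
    intro i
    induction i using Fin.reverseInduction with
    | last => exact ⟨(1, 0), by simp [hf]⟩
    | cast i ih =>
      rw [← sub_add_cancel (x i.castSucc) (p i • x i.succ)]
      exact add_mem (hle (hl i)) (Submodule.smul_mem _ _ ih)
  have hsurj : ∀ z, z ∈ LinearMap.range f := by
    intro z
    obtain ⟨w, rfl⟩ := Submodule.mkQ_surjective _ z
    have : (dvdSubmodule a).mkQ w = ∑ i, w i • x i := by
      simp_rw [x, ← map_smul, ← map_sum]
      congr 1
      ext i
      simp [Pi.single_apply]
    rw [this]
    exact sum_mem fun i _ => Submodule.smul_mem _ _ (hall i)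
  have hg : ∀ k : Fin (N + 1), (a 0 * ∏ i : Fin N, if i.castSucc < k then p i else 1) • x k ∈
      LinearMap.range l' := by
    intro k
    induction k using Fin.induction with
    | zero => simp [hx]
    | succ k ih =>
      have : (a 0 * ∏ i : Fin N, if i.castSucc < k.succ then p i else 1) =
          (a 0 * ∏ i : Fin N, if i.castSucc < k.castSucc then p i else 1) * p k := by
        rw [mul_assoc]
        congr 1
        rw [← Finset.mul_prod_erase _ _ (Finset.mem_univ k),
          ← Finset.mul_prod_erase (a := k) _ (fun i : Fin N => if i.castSucc < k.castSucc then p i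
            else 1)
            (Finset.mem_univ k)]
        simp only [Fin.castSucc_lt_succ, if_true, lt_self_iff_false, if_false, one_mul]
        rw [mul_comm]
        congr 1
        refine Finset.prod_congr rfl fun i hi => ?_
        have : i ≠ k := Finset.ne_of_mem_erase hi
        have e : i.castSucc < k.succ ↔ i.castSucc < k.castSucc := by
          rw [Fin.lt_def, Fin.lt_def]
          have : (i : ℕ) ≠ k := fun h => this (Fin.ext h)
          simp; omega
        simp only [e]
      rw [this, mul_smul]
      have h3 := Submodule.sub_mem _ ih (Submodule.smul_mem _
        (a 0 * ∏ i : Fin N, if i.castSucc < k.castSucc then p i else 1) (hl k))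
      rwa [smul_sub, sub_sub_cancel] at h3
  have hgl := hg (Fin.last N)
  set g : F[X] := a 0 * ∏ i : Fin N, if i.castSucc < Fin.last N then p i else 1 with hgdef
  have hgc : g * ∏ i, c i = ∏ i, a i := by
    rw [Fin.prod_univ_succ, hgdef, mul_assoc, ← Finset.prod_mul_distrib]
    congr 1
    refine Finset.prod_congr rfl fun i _ => ?_
    rw [if_pos (Fin.castSucc_lt_last i), hp, mul_comm]
  have hg0 : g ≠ 0 := by
    rintro h
    rw [h, zero_mul] at hgc
    exact Finset.prod_ne_zero_iff.2 (fun i _ => ha i) hgc.symm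
  have hge : g.natDegree = e := by
    have := congrArg natDegree hgc
    rw [natDegree_mul hg0 (Finset.prod_ne_zero_iff.2 fun i _ => hc i),
      natDegree_prod _ _ fun i _ => hc i, natDegree_prod _ _ fun i _ => ha i, he] at this
    omega
  refine ⟨f, fun z => ?_⟩
  obtain ⟨⟨d, w⟩, hd⟩ := hsurj z
  obtain ⟨w', hw'⟩ := hgl
  refine ⟨d % g, (d / g) • w' + w, ?_, ?_⟩
  · rw [mem_degreeLT, ← hge, ← degree_eq_natDegree hg0]
    exact degree_mod_lt d hg0
  · rw [← hd, hf, hf, map_add, map_smul, hw', smul_smul, ← add_assoc, ← add_smul]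
    congr 2
    rw [add_comm, mul_comm, EuclideanDomain.div_add_mod]

theorem rankSimilar_one {F : Type*} [Field F] {N : ℕ}
    {a b : Fin (N + 1) → F[X]} {c : Fin N → F[X]} (ha : ∀ i, a i ≠ 0) (hb : ∀ i, b i ≠ 0)
    (hc : ∀ i, c i ≠ 0)
    (ha1 : ∀ i, a i.castSucc ∣ c i) (ha2 : ∀ i, c i ∣ a i.succ)
    (hb1 : ∀ i, b i.castSucc ∣ c i) (hb2 : ∀ i, c i ∣ b i.succ)
    (hab : ∑ i, (a i).natDegree = ∑ i, (b i).natDegree) : RankSimilar 1 a b := by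
  have hle : ∑ i, (c i).natDegree ≤ ∑ i, (a i).natDegree := by
    rw [Fin.sum_univ_succ]
    refine le_add_left (Finset.sum_le_sum fun i _ => ?_)
    exact natDegree_le_of_dvd (ha2 i) (ha _)
  obtain ⟨e, he⟩ := Nat.exists_eq_add_of_le' hle
  obtain ⟨f, hf⟩ := exists_linearMap_torsionModule_surjective ha hc ha1 ha2 he
  obtain ⟨g, hg⟩ := exists_linearMap_torsionModule_surjective hb hc hb1 hb2 (hab ▸ he)
  have fa := finite_torsionModule ha
  have fb := finite_torsionModule hb
  have fc := finite_torsionModule hc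
  have fd : Module.Finite F (degreeLT F e) := Module.Finite.equiv (degreeLTEquiv F e).symm
  have hd : finrank F (degreeLT F e × TorsionModule c) = e + ∑ i, (c i).natDegree := by
    rw [finrank_prod, finrank_torsionModule hc, (degreeLTEquiv F e).finrank_eq, finrank_fin_fun]
  let ι : (degreeLT F e × TorsionModule c) →ₗ[F] (F[X] × TorsionModule c) :=
    LinearMap.prodMap (Submodule.subtype _) LinearMap.id
  have key : ∀ {a : Fin (N + 1) → F[X]} (_ : ∀ i, a i ≠ 0)
      (_ : ∑ i, (a i).natDegree = e + ∑ i, (c i).natDegree)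
      (f : (F[X] × TorsionModule c) →ₗ[F[X]] TorsionModule a),
      (∀ z, ∃ (ρ : F[X]) (w : TorsionModule c), ρ ∈ degreeLT F e ∧ f (ρ, w) = z) →
      Function.Bijective (f.restrictScalars F ∘ₗ ι) := by
    intro a ha he f hf
    have fa := finite_torsionModule ha
    have hs : Function.Surjective (f.restrictScalars F ∘ₗ ι) := fun z => by
      obtain ⟨ρ, w, hρ, h⟩ := hf z
      exact ⟨(⟨ρ, hρ⟩, w), h⟩
    refine ⟨(LinearMap.injective_iff_surjective_of_finrank_eq_finrank ?_).2 hs, hs⟩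
    rw [hd, finrank_torsionModule ha, he]
  let Φ := LinearEquiv.ofBijective _ (key ha he f hf)
  let Ψ := LinearEquiv.ofBijective _ (key hb (hab ▸ he) g hg)
  have hΦ : ∀ z, Φ z = f (z.1, z.2) := fun z => rfl
  have hΨ : ∀ z, Ψ z = g (z.1, z.2) := fun z => rfl
  refine ⟨Φ.symm.trans Ψ, ?_⟩
  set S := commX ((Φ.symm.trans Ψ : _ ≃ₗ[F] _) : TorsionModule a →ₗ[F] TorsionModule b) with hS
  let t : (degreeLT F e × TorsionModule c) →ₗ[F] F :=
    lcoeff F (e - 1) ∘ₗ Submodule.subtype _ ∘ₗ LinearMap.fst F _ _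
  have hker : ∀ z, t z = 0 → S (Φ z) = 0 := by
    rintro ⟨ρ, w⟩ hz
    have hz : (ρ : F[X]).coeff (e - 1) = 0 := hz
    have hmem : X * (ρ : F[X]) ∈ degreeLT F e := by
      rw [mem_degreeLT, degree_lt_iff_coeff_zero]
      have hρ := ρ.2
      rw [mem_degreeLT, degree_lt_iff_coeff_zero] at hρ
      intro m hm
      cases m with
      | zero => simp
      | succ m =>
        rw [coeff_X_mul]
        by_cases hme : m = e - 1
        · rw [hme, hz]
        · exact hρ m (by omega)
    have h1 : (X : F[X]) • Φ (ρ, w) = Φ (⟨X * (ρ : F[X]), hmem⟩, (X : F[X]) • w) := by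
      rw [hΦ, hΦ, ← map_smul]
      rfl
    have h2 : (X : F[X]) • Ψ (ρ, w) = Ψ (⟨X * (ρ : F[X]), hmem⟩, (X : F[X]) • w) := by
      rw [hΨ, hΨ, ← map_smul]
      rfl
    rw [hS, commX_apply, h1]
    simp [h2]
  have hfac : ∃ y, ∀ z, S (Φ z) = t z • y := by
    by_cases ht : ∃ z, t z ≠ 0
    · obtain ⟨z, hz⟩ := ht
      refine ⟨(t z)⁻¹ • S (Φ z), fun z' => ?_⟩
      have := hker (z' - (t z' * (t z)⁻¹) • z) (by simp [hz])
      rw [map_sub, map_sub, map_smul, map_smul, sub_eq_zero] at this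
      rw [this, smul_smul]
    · push Not at ht
      exact ⟨0, fun z => by rw [hker z (ht z), smul_zero]⟩
  obtain ⟨y, hy⟩ := hfac
  have hle : LinearMap.range S ≤ Submodule.span F {y} := by
    rintro _ ⟨z, rfl⟩
    rw [← Φ.apply_symm_apply z, hy]
    exact Submodule.smul_mem _ _ (Submodule.mem_span_singleton_self y)
  refine (Submodule.rank_mono hle).trans ?_
  simpa using rank_span_le (R := F) ({y} : Set (TorsionModule b))

/-- A divisibility chain indexed by `ℤ`, made of units below the range `1, …, n`, and zero
above it. -/
structure IsDvdChain {F : Type*} [Field F] (n : ℕ) (α : ℤ → F[X]) : Prop where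
  isUnit : ∀ j ≤ 0, IsUnit (α j)
  eq_zero : ∀ j, (n : ℤ) < j → α j = 0
  ne_zero : ∀ j ≤ (n : ℤ), α j ≠ 0
  dvd : ∀ i j, i ≤ j → α i ∣ α j

/-- Symmetric interlacing of two divisibility chains. -/
def ChainInterlace {F : Type*} [Field F] (r : ℕ) (α β : ℤ → F[X]) : Prop :=
  ∀ j : ℤ, α (j - r) ∣ β j ∧ β (j - r) ∣ α j

theorem ChainInterlace.symm {F : Type*} [Field F] {r : ℕ} {α β : ℤ → F[X]}
    (h : ChainInterlace r α β) : ChainInterlace r β α := fun j => ⟨(h j).2, (h j).1⟩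

theorem sum_range_shift {n : ℕ} (s : ℕ) {h : ℤ → ℕ} (h0 : ∀ j ≤ 0, h j = 0)
    (h1 : ∀ j, (n : ℤ) - s < j → h j = 0) :
    ∑ i ∈ Finset.range n, h ((i : ℤ) + 1 - s) = ∑ i ∈ Finset.range n, h ((i : ℤ) + 1) := by
  by_cases hs : s ≤ n
  · obtain ⟨m, rfl⟩ := Nat.exists_eq_add_of_le hs
    rw [Finset.sum_range_add, add_comm s m, Finset.sum_range_add]
    rw [Finset.sum_eq_zero (s := Finset.range s), Finset.sum_eq_zero (s := Finset.range s)]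
    · rw [zero_add, add_zero]
      refine Finset.sum_congr rfl fun i _ => congrArg h ?_
      push_cast; ring
    · intro i hi
      exact h1 _ (by push_cast; omega)
    · intro i hi
      rw [Finset.mem_range] at hi
      exact h0 _ (by omega)
  · rw [Finset.sum_eq_zero, Finset.sum_eq_zero]
    · intro i hi
      exact h1 _ (by omega)
    · intro i hi
      rw [Finset.mem_range] at hi
      exact h0 _ (by omega)

section
open scoped Classical

theorem natDegree_lcm_add_natDegree_gcd {F : Type*} [Field F] {x y : F[X]} (hx : x ≠ 0)
    (hy : y ≠ 0) :
    (EuclideanDomain.lcm x y).natDegree + (EuclideanDomain.gcd x y).natDegree = x.natDegree +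
      y.natDegree := by
  have h : EuclideanDomain.gcd x y ≠ 0 := fun h => hx (EuclideanDomain.gcd_eq_zero_iff.1 h).1
  have h' : EuclideanDomain.lcm x y ≠ 0 := fun h => (EuclideanDomain.lcm_eq_zero_iff.1 h).elim hx hy
  rw [add_comm, ← natDegree_mul h h', EuclideanDomain.gcd_mul_lcm, natDegree_mul hx hy]

theorem exists_intermediate_chain {F : Type*} [Field F] {n s : ℕ} (hn : 0 < n) (hs : 0 < s)
    {α β : ℤ → F[X]} (hα : IsDvdChain n α) (hβ : IsDvdChain n β)
    (h : ChainInterlace (s + 1) α β)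
    (hdeg : ∑ i ∈ Finset.range n, (α ((i : ℤ) + 1)).natDegree =
      ∑ i ∈ Finset.range n, (β ((i : ℤ) + 1)).natDegree)
    (hle : ∑ i ∈ Finset.range n, (EuclideanDomain.gcd (α ((i : ℤ) + 1))
      (β ((i : ℤ) + 1 + s))).natDegree ≤
      ∑ i ∈ Finset.range n, (EuclideanDomain.gcd (β ((i : ℤ) + 1))
        (α ((i : ℤ) + 1 + s))).natDegree) :
    ∃ γ : ℤ → F[X], IsDvdChain n γ ∧ ChainInterlace 1 α γ ∧ ChainInterlace s γ β ∧
      ∑ i ∈ Finset.range n, (γ ((i : ℤ) + 1)).natDegree =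
        ∑ i ∈ Finset.range n, (α ((i : ℤ) + 1)).natDegree := by
  let g : ℤ → F[X] := fun j => EuclideanDomain.lcm (EuclideanDomain.gcd (α j) (β (j + s)))
    (β (j - s))
  let v : ℤ → ℕ := fun j => (EuclideanDomain.gcd (β j) (α (j + s))).natDegree
  have hα1 : ∀ j, α (j - 1) ∣ g j := fun j => by
    refine dvd_trans (EuclideanDomain.dvd_gcd (hα.dvd _ _ (by omega)) ?_)
      (EuclideanDomain.dvd_lcm_left _ _)
    have := (h (j + s)).1
    rwa [show j + s - ((s + 1 : ℕ) : ℤ) = j - 1 by push_cast; ring] at this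
  have hα2 : ∀ j, g (j - 1) ∣ α j := fun j => by
    refine EuclideanDomain.lcm_dvd ((EuclideanDomain.gcd_dvd_left _ _).trans
      (hα.dvd _ _ (by omega))) ?_
    have := (h j).2
    rwa [show j - ((s + 1 : ℕ) : ℤ) = j - 1 - s by push_cast; ring] at this
  have hβ1 : ∀ j, g (j - s) ∣ β j := fun j => by
    refine EuclideanDomain.lcm_dvd ((EuclideanDomain.gcd_dvd_right _ _).trans
      (hβ.dvd _ _ (by omega))) (hβ.dvd _ _ (by omega))
  have hβ2 : ∀ j, β (j - s) ∣ g j := fun j => EuclideanDomain.dvd_lcm_right _ _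
  have hgd : ∀ i j, i ≤ j → g i ∣ g j := fun i j hij =>
    EuclideanDomain.lcm_dvd (dvd_trans (EuclideanDomain.dvd_gcd
      ((EuclideanDomain.gcd_dvd_left _ _).trans (hα.dvd _ _ hij))
      ((EuclideanDomain.gcd_dvd_right _ _).trans (hβ.dvd _ _ (by omega))))
        (EuclideanDomain.dvd_lcm_left _ _))
      ((hβ.dvd _ _ (by omega)).trans (EuclideanDomain.dvd_lcm_right _ _))
  have hgu : ∀ j ≤ 0, IsUnit (g j) := fun j hj => by
    have h1 := hα.isUnit j hj
    have h2 := hβ.isUnit (j - s) (by omega)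
    refine isUnit_of_dvd_one (EuclideanDomain.lcm_dvd
      ((EuclideanDomain.gcd_dvd_left _ _).trans h1.dvd) h2.dvd)
  have hg0 : ∀ j, (n : ℤ) < j → g j = 0 := fun j hj => by
    simp only [g]
    rw [hα.eq_zero j hj, hβ.eq_zero (j + s) (by omega), EuclideanDomain.lcm_eq_zero_iff]
    left
    exact EuclideanDomain.gcd_eq_zero_iff.2 ⟨rfl, rfl⟩
  have hgcd : ∀ j ≤ (n : ℤ), EuclideanDomain.gcd (α j) (β (j + s)) ≠ 0 := fun j hj h =>
    hα.ne_zero j hj (EuclideanDomain.gcd_eq_zero_iff.1 h).1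
  have hgn : ∀ j ≤ (n : ℤ), g j ≠ 0 := fun j hj h =>
    (EuclideanDomain.lcm_eq_zero_iff.1 h).elim (hgcd j hj) (hβ.ne_zero _ (by omega))
  have hv : ∀ j ≤ (n : ℤ), v j ≤ (β j).natDegree := fun j hj =>
    natDegree_le_of_dvd (EuclideanDomain.gcd_dvd_left _ _) (hβ.ne_zero j hj)
  have hdj : ∀ j ≤ (n : ℤ), (g j).natDegree =
      (EuclideanDomain.gcd (α j) (β (j + s))).natDegree + ((β (j - s)).natDegree - v (j - s)) := by
    intro j hj
    have h1 := natDegree_lcm_add_natDegree_gcd (hgcd j hj) (hβ.ne_zero (j - s) (by omega))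
    have h2 : (EuclideanDomain.gcd (EuclideanDomain.gcd (α j) (β (j + s))) (β (j - s))).natDegree =
      v (j - s) := by
      simp only [v, sub_add_cancel]
      have hne : β (j - s) ≠ 0 := hβ.ne_zero _ (by omega)
      apply le_antisymm
      · refine natDegree_le_of_dvd (EuclideanDomain.dvd_gcd (EuclideanDomain.gcd_dvd_right _ _)
          ((EuclideanDomain.gcd_dvd_left _ _).trans (EuclideanDomain.gcd_dvd_left _ _))) ?_
        exact fun h => hne (EuclideanDomain.gcd_eq_zero_iff.1 h).1
      · refine natDegree_le_of_dvd (EuclideanDomain.dvd_gcd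
          (EuclideanDomain.dvd_gcd (EuclideanDomain.gcd_dvd_right _ _)
          ((EuclideanDomain.gcd_dvd_left _ _).trans (hβ.dvd _ _ (by omega))))
            (EuclideanDomain.gcd_dvd_left _ _)) ?_
        exact fun h => hne (EuclideanDomain.gcd_eq_zero_iff.1 h).2
    have h3 := hv (j - s) (by omega)
    simp only [g]
    omega
  have hsum : ∑ i ∈ Finset.range n, (g ((i : ℤ) + 1)).natDegree ≤
      ∑ i ∈ Finset.range n, (α ((i : ℤ) + 1)).natDegree := by
    have h1 : ∑ i ∈ Finset.range n, (g ((i : ℤ) + 1)).natDegree =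
        ∑ i ∈ Finset.range n, (EuclideanDomain.gcd (α ((i : ℤ) + 1))
          (β ((i : ℤ) + 1 + s))).natDegree +
        ∑ i ∈ Finset.range n, ((β ((i : ℤ) + 1 - s)).natDegree - v ((i : ℤ) + 1 - s)) := by
      rw [← Finset.sum_add_distrib]
      refine Finset.sum_congr rfl fun i hi => hdj _ ?_
      rw [Finset.mem_range] at hi
      omega
    have h2 := sum_range_shift (n := n) s (h := fun j => (β j).natDegree - v j)
      (fun j hj => by simp [natDegree_eq_zero_of_isUnit (hβ.isUnit j hj)])
      (fun j hj => by
        simp only [v]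
        rw [hα.eq_zero (j + s) (by omega), EuclideanDomain.gcd_zero_right, Nat.sub_self])
    have h3 : ∑ i ∈ Finset.range n, ((β ((i : ℤ) + 1)).natDegree - v ((i : ℤ) + 1)) +
        ∑ i ∈ Finset.range n, v ((i : ℤ) + 1) =
        ∑ i ∈ Finset.range n, (β ((i : ℤ) + 1)).natDegree := by
      rw [← Finset.sum_add_distrib]
      refine Finset.sum_congr rfl fun i hi => Nat.sub_add_cancel (hv _ ?_)
      rw [Finset.mem_range] at hi
      omega
    rw [h1, h2]
    simp only [v] at h3 ⊢
    omega
  obtain ⟨k, hk⟩ := Nat.exists_eq_add_of_le hsum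
  let γ : ℤ → F[X] := fun j => if j = n then g j * X ^ k else g j
  have hγn : ∀ j : ℤ, j ≠ (n : ℤ) → γ j = g j := fun j hj => if_neg hj
  have hgγ : ∀ j, g j ∣ γ j := fun j => by
    simp only [γ]
    split_ifs
    · exact dvd_mul_right _ _
    · exact dvd_rfl
  have hγz : ∀ j, (n : ℤ) < j → γ j = 0 := fun j hj => by rw [hγn j (by omega), hg0 j hj]
  refine ⟨γ, ⟨fun j hj => ?_, hγz, fun j hj => ?_, fun i j hij => ?_⟩,
    fun j => ⟨?_, ?_⟩, fun j => ⟨?_, ?_⟩, ?_⟩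
  · rw [hγn j (by omega)]
    exact hgu j hj
  · simp only [γ]
    split_ifs
    · exact mul_ne_zero (hgn j hj) (pow_ne_zero _ X_ne_zero)
    · exact hgn j hj
  · rcases lt_trichotomy i n with hi | hi | hi
    · rw [hγn i (by omega)]
      exact (hgd i j hij).trans (hgγ j)
    · rcases hij.lt_or_eq with hj | rfl
      · rw [hγz j (by omega)]
        exact dvd_zero _
      · exact dvd_rfl
    · rw [hγz j (by omega)]
      exact dvd_zero _
  · exact (hα1 j).trans (hgγ j)
  · by_cases hj : j - (1 : ℕ) = n
    · rw [hα.eq_zero j (by omega)]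
      exact dvd_zero _
    · rw [hγn _ hj]
      exact hα2 j
  · by_cases hj : j - s = n
    · rw [hβ.eq_zero j (by omega)]
      exact dvd_zero _
    · rw [hγn _ hj]
      exact hβ1 j
  · exact (hβ2 j).trans (hgγ j)
  · obtain ⟨N, rfl⟩ := Nat.exists_eq_succ_of_ne_zero hn.ne'
    rw [hk, Finset.sum_range_succ, Finset.sum_range_succ (n := N)]
    have : γ ((N : ℤ) + 1) = g ((N : ℤ) + 1) * X ^ k := if_pos (by push_cast; ring)
    rw [this, natDegree_mul (hgn _ (by push_cast; omega)) (pow_ne_zero _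
      X_ne_zero), natDegree_X_pow,
      ← add_assoc]
    congr 2
    refine Finset.sum_congr rfl fun i hi => ?_
    rw [Finset.mem_range] at hi
    rw [hγn _ (by push_cast; omega)]

theorem rankSimilar_of_chainInterlace_one {F : Type*} [Field F] {n : ℕ} (hn : 0 < n)
    {α β : ℤ → F[X]} (hα : IsDvdChain n α) (hβ : IsDvdChain n β)
    (h : ChainInterlace 1 α β)
    (hdeg : ∑ i ∈ Finset.range n, (α ((i : ℤ) + 1)).natDegree =
      ∑ i ∈ Finset.range n, (β ((i : ℤ) + 1)).natDegree) :
    RankSimilar 1 (fun i : Fin n => α ((i : ℤ) + 1)) (fun i : Fin n => β ((i : ℤ) + 1)) := by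
  obtain ⟨N, rfl⟩ := Nat.exists_eq_succ_of_ne_zero hn.ne'
  have hαn : ∀ i : Fin (N + 1), α ((i : ℤ) + 1) ≠ 0 := fun i => hα.ne_zero _ (by omega)
  have hβn : ∀ i : Fin (N + 1), β ((i : ℤ) + 1) ≠ 0 := fun i => hβ.ne_zero _ (by omega)
  refine rankSimilar_one (c := fun i : Fin N => EuclideanDomain.lcm (α ((i : ℤ) + 1))
    (β ((i : ℤ) + 1)))
    hαn hβn ?_ ?_ ?_ ?_ ?_ ?_
  · exact fun i h => (EuclideanDomain.lcm_eq_zero_iff.1 h).elim (hαn i.castSucc) (hβn i.castSucc)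
  · exact fun i => EuclideanDomain.dvd_lcm_left _ _
  · intro i
    refine EuclideanDomain.lcm_dvd (hα.dvd _ _ (by simp)) ?_
    have := (h (((i.succ : Fin (N + 1)) : ℕ) + 1)).2
    simpa using this
  · exact fun i => EuclideanDomain.dvd_lcm_right _ _
  · intro i
    refine EuclideanDomain.lcm_dvd ?_ (hβ.dvd _ _ (by simp))
    have := (h (((i.succ : Fin (N + 1)) : ℕ) + 1)).1
    simpa using this
  · rwa [Finset.sum_range, Finset.sum_range] at hdeg

theorem rankSimilar_of_chainInterlace {F : Type*} [Field F] {n : ℕ} (hn : 0 < n) (r : ℕ) :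
    ∀ {α β : ℤ → F[X]}, IsDvdChain n α → IsDvdChain n β → ChainInterlace r α β →
    ∑ i ∈ Finset.range n, (α ((i : ℤ) + 1)).natDegree =
      ∑ i ∈ Finset.range n, (β ((i : ℤ) + 1)).natDegree →
    RankSimilar r (fun i : Fin n => α ((i : ℤ) + 1)) (fun i : Fin n => β ((i : ℤ) + 1)) := by
  induction r with
  | zero =>
    intro α β hα hβ h hdeg
    refine rankSimilar_zero_of_associated fun i => ?_
    have := h ((i : ℤ) + 1)
    simp only [Nat.cast_zero, sub_zero] at this
    exact associated_of_dvd_dvd this.1 this.2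
  | succ s ih =>
    intro α β hα hβ h hdeg
    rcases Nat.eq_zero_or_pos s with rfl | hs
    · exact rankSimilar_of_chainInterlace_one hn hα hβ h hdeg
    have key : ∀ {α β : ℤ → F[X]}, IsDvdChain n α → IsDvdChain n β → ChainInterlace (s + 1) α β →
        ∑ i ∈ Finset.range n, (α ((i : ℤ) + 1)).natDegree =
          ∑ i ∈ Finset.range n, (β ((i : ℤ) + 1)).natDegree →
        ∑ i ∈ Finset.range n, (EuclideanDomain.gcd (α ((i : ℤ) + 1))
          (β ((i : ℤ) + 1 + s))).natDegree ≤
          ∑ i ∈ Finset.range n, (EuclideanDomain.gcd (β ((i : ℤ) + 1))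
            (α ((i : ℤ) + 1 + s))).natDegree →
        RankSimilar (s + 1) (fun i : Fin n => α ((i : ℤ) + 1))
          (fun i : Fin n => β ((i : ℤ) + 1)) := by
      intro α β hα hβ h hdeg hle
      obtain ⟨γ, hγ, h1, h2, h3⟩ := exists_intermediate_chain hn hs hα hβ h hdeg hle
      have e1 := rankSimilar_of_chainInterlace_one hn hα hγ h1 h3.symm
      have e2 := ih hγ hβ h2 (h3.trans hdeg)
      rw [add_comm s 1]
      exact e1.trans e2
    rcases le_total
      (∑ i ∈ Finset.range n, (EuclideanDomain.gcd (α ((i : ℤ) + 1))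
        (β ((i : ℤ) + 1 + s))).natDegree)
      (∑ i ∈ Finset.range n, (EuclideanDomain.gcd (β ((i : ℤ) + 1))
        (α ((i : ℤ) + 1 + s))).natDegree) with hle | hle
    · exact key hα hβ h hdeg hle
    · exact (key hβ hα h.symm hdeg.symm hle).symm
end

section
variable {F : Type*} [Field F]

/-- Setting `s = X`, `t = 1` in a polynomial in `s, t`. -/
noncomputable def dehom : MvPolynomial (Fin 2) F →ₐ[F] F[X] := MvPolynomial.aeval ![X, 1]

@[simp] theorem dehom_X_zero : dehom (MvPolynomial.X 0 : MvPolynomial (Fin 2) F) = X := by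
  simp [dehom]

@[simp] theorem dehom_X_one : dehom (MvPolynomial.X 1 : MvPolynomial (Fin 2) F) = 1 := by
  simp [dehom]

theorem dehom_dvd {p q : MvPolynomial (Fin 2) F} (h : p ∣ q) : dehom p ∣ dehom q := by
  obtain ⟨c, rfl⟩ := h
  exact ⟨dehom c, by rw [map_mul]⟩

theorem natDegree_dehom_le {p : MvPolynomial (Fin 2) F} {k : ℕ} (hp : p.IsHomogeneous k) :
    (dehom p).natDegree ≤ k := by
  rw [dehom, p.as_sum, map_sum]
  refine natDegree_sum_le_of_forall_le _ _ fun d hd => ?_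
  rw [MvPolynomial.aeval_monomial, Finsupp.prod_fintype _ _ (by simp)]
  have h := hp (MvPolynomial.mem_support_iff.1 hd)
  rw [Finsupp.weight_apply, Finsupp.sum_fintype _ _ (by simp)] at h
  simp only [Fin.sum_univ_two, Pi.one_apply, smul_eq_mul, mul_one] at h
  simp only [Fin.prod_univ_two, Matrix.cons_val_zero, Matrix.cons_val_one, one_pow, mul_one]
  refine (natDegree_mul_le).trans ?_
  rw [natDegree_X_pow, ← C_eq_algebraMap, natDegree_C]
  omega

theorem homogenize_dehom {p : MvPolynomial (Fin 2) F} {k : ℕ} (hp : p.IsHomogeneous k) :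
    (dehom p).homogenize k = p := homogenize_eq_of_isHomogeneous hp rfl

theorem dehom_homogenize {p : F[X]} {k : ℕ} (hp : p.natDegree ≤ k) :
    dehom (p.homogenize k) = p := aeval_homogenize_X_one p hp

theorem dehom_ne_zero {p : MvPolynomial (Fin 2) F} {k : ℕ} (hp : p.IsHomogeneous k) (h : p ≠ 0) :
    dehom p ≠ 0 := fun h0 => h (by rw [← homogenize_dehom hp, h0, homogenize_zero])

theorem IsGCDOf.map_dehom {S : Set (MvPolynomial (Fin 2) F)} {g : MvPolynomial (Fin 2) F} {k : ℕ}
    (hS : ∀ p ∈ S, p.IsHomogeneous k) (hg : IsGCDOf g S) : IsGCDOf (dehom g) (dehom '' S) := by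
  constructor
  · rintro _ ⟨p, hp, rfl⟩
    exact dehom_dvd (hg.1 p hp)
  · intro d hd
    have : d.homogenize d.natDegree ∣ g := by
      refine hg.2 _ fun p hp => ?_
      rcases eq_or_ne p 0 with rfl | h0
      · exact dvd_zero _
      obtain ⟨q, hq⟩ := hd _ ⟨p, hp, rfl⟩
      have h1 := dehom_ne_zero (hS p hp) h0
      have h2 := natDegree_dehom_le (hS p hp)
      have h3 : d ≠ 0 := by rintro rfl; simp_all
      have h4 : q ≠ 0 := by rintro rfl; simp_all
      rw [hq, natDegree_mul h3 h4] at h2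
      rw [← homogenize_dehom (hS p hp), hq, ← Nat.add_sub_of_le (le_of_add_le_left h2),
        homogenize_mul _ _ le_rfl (by omega)]
      exact dvd_mul_right _ _
    have := dehom_dvd this
    rwa [dehom_homogenize le_rfl] at this

theorem minorsSet_map {R S : Type*} [CommRing R] [CommRing S] {m n : ℕ} (f : R →+* S)
    (M : Matrix (Fin m) (Fin n) R) (k : ℕ) : minorsSet (M.map f) k = f '' minorsSet M k := by
  ext x
  constructor
  · rintro ⟨ri, ci, hri, hci, rfl⟩
    refine ⟨_, ⟨ri, ci, hri, hci, rfl⟩, ?_⟩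
    rw [RingHom.map_det]
    rfl
  · rintro ⟨_, ⟨ri, ci, hri, hci, rfl⟩, rfl⟩
    refine ⟨ri, ci, hri, hci, ?_⟩
    rw [RingHom.map_det]
    rfl

theorem isHomogeneous_of_mem_minorsSet {m n k : ℕ} {G₀ G₁ : Matrix (Fin m) (Fin n) F}
    {p : MvPolynomial (Fin 2) F} (hp : p ∈ minorsSet (homPencil G₀ G₁) k) :
    p.IsHomogeneous k := by
  obtain ⟨ri, ci, -, -, rfl⟩ := hp
  rw [Matrix.det_apply]
  refine MvPolynomial.IsHomogeneous.sum _ _ _ fun σ _ => ?_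
  have h : (∏ i, (homPencil G₀ G₁).submatrix ri ci (σ i) i).IsHomogeneous k := by
    have := MvPolynomial.IsHomogeneous.prod Finset.univ
      (fun i => (homPencil G₀ G₁).submatrix ri ci (σ i) i) (fun _ : Fin k => 1) fun i _ => by
        simp only [homPencil, Matrix.submatrix_apply, Matrix.add_apply, Matrix.smul_apply,
          Matrix.map_apply, smul_eq_mul]
        refine MvPolynomial.IsHomogeneous.add ?_ ?_
        · exact (MvPolynomial.isHomogeneous_X F 1).mul (MvPolynomial.isHomogeneous_C _ _)
        · exact (MvPolynomial.isHomogeneous_X F 0).mul (MvPolynomial.isHomogeneous_C _ _)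
    simpa using this
  rw [Units.smul_def, zsmul_eq_mul, ← map_intCast (MvPolynomial.C : F →+* MvPolynomial (Fin 2) F)]
  have := (MvPolynomial.isHomogeneous_C (Fin 2) ((Equiv.Perm.sign σ : ℤ) : F)).mul h
  rwa [zero_add] at this

theorem map_dehom_homPencil {m n : ℕ} (G₀ G₁ : Matrix (Fin m) (Fin n) F) :
    (homPencil G₀ G₁).map dehom = pencilOf G₀ G₁ := by
  refine Matrix.ext fun i j => ?_
  simp [homPencil, pencilOf]

theorem IsHomogeneousIF.isGCDOf_dehom {n : ℕ} {G₀ G₁ : Matrix (Fin n) (Fin n) F}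
    {φ : ℕ → MvPolynomial (Fin 2) F} (h : IsHomogeneousIF G₀ G₁ φ) (k : ℕ) (hk : k ≤ n) :
    IsGCDOf (∏ i ∈ Finset.range k, dehom (φ i)) (minorsSet (pencilOf G₀ G₁) k) := by
  have := (h k hk).map_dehom fun p hp => isHomogeneous_of_mem_minorsSet hp
  rw [map_prod] at this
  rw [← map_dehom_homPencil]
  exact (minorsSet_map (dehom (F := F) : MvPolynomial (Fin 2) F →+* F[X]) (homPencil G₀ G₁) k) ▸
    this

theorem dehom_det_homPencil {n : ℕ} (G₀ G₁ : Matrix (Fin n) (Fin n) F) :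
    dehom (homPencil G₀ G₁).det = (pencilOf G₀ G₁).det := by
  rw [← map_dehom_homPencil]
  exact RingHom.map_det (dehom (F := F) : MvPolynomial (Fin 2) F →+* F[X]) (homPencil G₀ G₁)

theorem det_pencilOf_ne_zero_iff {n : ℕ} (G₀ G₁ : Matrix (Fin n) (Fin n) F) :
    (pencilOf G₀ G₁).det ≠ 0 ↔ (homPencil G₀ G₁).det ≠ 0 := by
  rw [← dehom_det_homPencil]
  constructor
  · intro h h0
    exact h (by rw [h0, map_zero])
  · exact dehom_ne_zero (isHomogeneous_of_mem_minorsSet (det_mem_minorsSet _))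

/-- The automorphism `s ↦ t + a s`, `t ↦ s`. -/
noncomputable def chartEquiv (a : F) : MvPolynomial (Fin 2) F ≃ₐ[F] MvPolynomial (Fin 2) F :=
  AlgEquiv.ofAlgHom
    (MvPolynomial.aeval ![MvPolynomial.X 1 + MvPolynomial.C a * MvPolynomial.X 0,
      MvPolynomial.X 0])
    (MvPolynomial.aeval ![MvPolynomial.X 1, MvPolynomial.X 0 - MvPolynomial.C a * MvPolynomial.X 1])
    (by ext i : 1; fin_cases i <;> simp)
    (by ext i : 1; fin_cases i <;> simp)

@[simp] theorem chartEquiv_C (a b : F) : chartEquiv a (MvPolynomial.C b) = MvPolynomial.C b := by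
  simp [chartEquiv]

@[simp] theorem chartEquiv_X_zero (a : F) : chartEquiv a (MvPolynomial.X 0) =
    MvPolynomial.X 1 + MvPolynomial.C a * MvPolynomial.X 0 := by
  simp [chartEquiv]

@[simp] theorem chartEquiv_X_one (a : F) :
    chartEquiv a (MvPolynomial.X 1) = MvPolynomial.X 0 := by
  simp [chartEquiv]

theorem chartEquiv_dvd (a : F) {p q : MvPolynomial (Fin 2) F} (h : p ∣ q) :
    chartEquiv a p ∣ chartEquiv a q := by
  obtain ⟨c, rfl⟩ := h
  exact ⟨chartEquiv a c, by rw [map_mul]⟩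

theorem map_chartEquiv_homPencil (a : F) {m n : ℕ} (G₀ G₁ : Matrix (Fin m) (Fin n) F) :
    (homPencil G₀ G₁).map (chartEquiv a) = homPencil G₁ (G₀ + a • G₁) := by
  refine Matrix.ext fun i j => ?_
  simp [homPencil]
  ring

theorem det_homPencil_chart (a : F) {n : ℕ} {G₀ G₁ : Matrix (Fin n) (Fin n) F}
    (h : (homPencil G₀ G₁).det ≠ 0) : (homPencil G₁ (G₀ + a • G₁)).det ≠ 0 := by
  rw [← map_chartEquiv_homPencil]
  have := RingHom.map_det ((chartEquiv a : MvPolynomial (Fin 2) F ≃ₐ[F] _) : 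
    MvPolynomial (Fin 2) F →+* MvPolynomial (Fin 2) F) (homPencil G₀ G₁)
  intro h0
  apply h
  apply (chartEquiv a).injective
  rw [map_zero]
  exact this.trans h0

theorem IsHomogeneousIF.chart (a : F) {n : ℕ} {G₀ G₁ : Matrix (Fin n) (Fin n) F}
    {φ : ℕ → MvPolynomial (Fin 2) F} (h : IsHomogeneousIF G₀ G₁ φ) :
    IsHomogeneousIF G₁ (G₀ + a • G₁) fun i => chartEquiv a (φ i) := by
  intro k hk
  have e : minorsSet (homPencil G₁ (G₀ + a • G₁)) k =
      chartEquiv a '' minorsSet (homPencil G₀ G₁) k := by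
    rw [← map_chartEquiv_homPencil]
    exact minorsSet_map ((chartEquiv a : MvPolynomial (Fin 2) F ≃ₐ[F] _) : 
      MvPolynomial (Fin 2) F →+* MvPolynomial (Fin 2) F) (homPencil G₀ G₁) k
  rw [e, ← map_prod]
  constructor
  · rintro _ ⟨p, hp, rfl⟩
    exact chartEquiv_dvd a ((h k hk).1 p hp)
  · intro d hd
    obtain ⟨d, rfl⟩ := (chartEquiv a).surjective d
    refine chartEquiv_dvd a ((h k hk).2 d fun p hp => ?_)
    exact (map_dvd_iff (chartEquiv a)).1 (hd _ ⟨p, hp, rfl⟩)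

theorem X_zero_pow_dvd_iff_of_dvd {f g : MvPolynomial (Fin 2) F} {d : ℕ}
    (hg : g.IsHomogeneous d) (h0 : g ≠ 0) (hfg : f ∣ g) (k : ℕ) :
    MvPolynomial.X 0 ^ k ∣ f ↔ (X : F[X]) ^ k ∣ dehom f := by
  constructor
  · intro h
    simpa using dehom_dvd h
  intro h
  have hp : Prime (MvPolynomial.X 0 : MvPolynomial (Fin 2) F) := MvPolynomial.X_prime
  have hf0 : f ≠ 0 := ne_zero_of_dvd_ne_zero h0 hfg
  obtain ⟨a, f', hf', rfl⟩ := WfDvdMonoid.max_power_factor hf0 hp.irreducible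
  obtain ⟨b, q, hq, hb⟩ := WfDvdMonoid.max_power_factor (dehom_ne_zero hg h0)
    (prime_X (R := F)).irreducible
  have hq0 : q ≠ 0 := by rintro rfl; simp at hq
  have hdeg := natDegree_dehom_le hg
  rw [hb, natDegree_mul (pow_ne_zero _ X_ne_zero) hq0, natDegree_X_pow] at hdeg
  have hg' : g = MvPolynomial.X 0 ^ b * q.homogenize (d - b) := by
    rw [← homogenize_dehom hg, hb]
    conv_lhs => rw [← Nat.add_sub_of_le (le_of_add_le_left hdeg)]
    rw [homogenize_mul _ _ (by simp) (by omega), homogenize_X_pow le_rfl]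
    simp
  have hrel : IsRelPrime f' (MvPolynomial.X 0 ^ b) :=
    ((hp.irreducible.isRelPrime_iff_not_dvd).2 hf').symm.pow_right
  have h1 : f' ∣ q.homogenize (d - b) := by
    refine hrel.dvd_of_dvd_mul_left ?_
    rw [← hg']
    exact (dvd_mul_left _ _).trans hfg
  have h2 := dehom_dvd h1
  rw [dehom_homogenize (by omega)] at h2
  have h3 : ¬ (X : F[X]) ∣ dehom f' := fun h => hq (h.trans h2)
  rw [map_mul, map_pow, dehom_X_zero] at h
  refine (pow_dvd_pow _ ?_).trans (dvd_mul_right _ _)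
  by_contra hlt
  push Not at hlt
  apply h3
  have h4 : (X : F[X]) ^ a * X ∣ X ^ a * dehom f' := by
    rw [← pow_succ]
    exact (pow_dvd_pow _ hlt).trans h
  exact (mul_dvd_mul_iff_left (pow_ne_zero _ X_ne_zero)).1 h4

theorem dehom_chartEquiv_homogenize {p : F[X]} {n : ℕ} (hp : p.natDegree ≤ n) :
    dehom (chartEquiv 0 (p.homogenize n)) = p.reflect n := by
  refine Polynomial.induction_with_natDegree_le
    (fun p => dehom (chartEquiv 0 (p.homogenize n)) = p.reflect n) n (by simp) ?_ ?_ p hp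
  · intro k c _ hk
    rw [homogenize_C_mul, homogenize_X_pow hk, reflect_C_mul_X_pow]
    simp [revAt_le hk]
  · intro p q _ _ h1 h2
    rw [homogenize_add, map_add, map_add, h1, h2, reflect_add]

theorem add_le_of_pow_dvd_dehom_chartEquiv {h : MvPolynomial (Fin 2) F} {n E : ℕ}
    (hh : h.IsHomogeneous n) (h0 : h ≠ 0) (hE : (X : F[X]) ^ E ∣ dehom (chartEquiv 0 h)) :
    (dehom h).natDegree + E ≤ n := by
  have hd := natDegree_dehom_le hh
  rw [← homogenize_dehom hh, dehom_chartEquiv_homogenize hd, X_pow_dvd_iff] at hE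
  by_contra hlt
  have := hE (n - (dehom h).natDegree) (by omega)
  rw [coeff_reflect, revAt_le (by omega), Nat.sub_sub_self hd] at this
  exact dehom_ne_zero hh h0 (leadingCoeff_eq_zero.1 this)
end

theorem dvd_det_of_isGCDOf {R : Type*} [CommRing R] {n : ℕ} {M : Matrix (Fin n) (Fin n) R}
    {α : ℕ → R} (hα : ∀ k ≤ n, IsGCDOf (∏ i ∈ Finset.range k, α i) (minorsSet M k)) {i : ℕ}
    (hi : i < n) : α i ∣ M.det :=
  (Finset.dvd_prod_of_mem α (Finset.mem_range.2 hi)).trans ((hα n le_rfl).1 _ (det_mem_minorsSet M))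

theorem exists_presentation_of_dvd {D : Type*} [CommRing D] [IsDomain D]
    [IsPrincipalIdealRing D] {n : ℕ} {M : Matrix (Fin n) (Fin n) D} (hM : M.det ≠ 0) {α : ℕ → D}
    (hα : ∀ k ≤ n, IsGCDOf (∏ i ∈ Finset.range k, α i) (minorsSet M k)) {a : Fin n → D} {c : D}
    (h1 : ∀ i, a i ∣ α i) (h2 : ∀ i : Fin n, α i ∣ c * a i) :
    ∃ q : (Fin n → D) →ₗ[D] TorsionModule a, Function.Surjective q ∧
      (∀ x, q (M.mulVec x) = 0) ∧ ∀ v, q v = 0 → ∃ x, c • v = M.mulVec x := by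
  obtain ⟨q, hq, hk⟩ := exists_presentation_of_isGCDOf hM hα
  have hle : dvdSubmodule (fun i : Fin n => α i) ≤ dvdSubmodule a := fun w hw i =>
    (h1 i).trans (hw i)
  refine ⟨Submodule.factor hle ∘ₗ q, ?_, fun x => ?_, fun v hv => ?_⟩
  · rw [LinearMap.coe_comp]
    exact (Submodule.factor_surjective hle).comp hq
  · rw [LinearMap.comp_apply, (hk _).2 ⟨x, rfl⟩, map_zero]
  · rw [LinearMap.comp_apply] at hv
    rw [← hk, map_smul]
    obtain ⟨w, hw⟩ := Submodule.mkQ_surjective _ (q v)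
    rw [← hw] at hv ⊢
    rw [← map_smul, Submodule.mkQ_apply, Submodule.Quotient.mk_eq_zero]
    have hv' : (dvdSubmodule a).mkQ w = 0 := hv
    rw [Submodule.mkQ_apply, Submodule.Quotient.mk_eq_zero] at hv'
    exact fun i => (h2 i).trans (mul_dvd_mul_left c (hv' i))

section
variable {F : Type*} [Field F]

theorem reflect_pencilOf_mulVec {n N : ℕ} (A₀ A₁ : Matrix (Fin n) (Fin n) F)
    {x : Fin n → F[X]} (hx : ∀ i, (x i).natDegree ≤ N) (i : Fin n) :
    ((pencilOf A₀ A₁).mulVec x i).reflect (1 + N) =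
      (pencilOf A₁ A₀).mulVec (fun j => (x j).reflect N) i := by
  have hsum : ∀ f : Fin n → F[X], (∑ j, f j).reflect (1 + N) = ∑ j, (f j).reflect (1 + N) :=
    fun f => Finset.sum_hom_rel (r := fun a b : F[X] => a.reflect (1 + N) = b) reflect_zero
      fun i a b h => by rw [reflect_add, h]
  simp only [Matrix.mulVec, dotProduct]
  rw [hsum]
  refine Finset.sum_congr rfl fun j _ => ?_
  have h1 : (pencilOf A₀ A₁ i j).natDegree ≤ 1 := by
    simp only [pencilOf, Matrix.add_apply, Matrix.map_apply, Matrix.smul_apply, smul_eq_mul]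
    compute_degree
  rw [reflect_mul _ _ h1 (hx j)]
  congr 1
  simp only [pencilOf, Matrix.add_apply, Matrix.map_apply, Matrix.smul_apply, smul_eq_mul]
  rw [reflect_add, reflect_C, mul_comm X, reflect_C_mul, reflect_one_X]
  ring

theorem eq_zero_of_mem_range_charts {n : ℕ} {A₀ A₁ : Matrix (Fin n) (Fin n) F}
    (h : (pencilOf A₁ A₀).det ≠ 0) {v : Fin n → F} {x y : Fin n → F[X]} {c : F[X]}
    (hc : ¬ X ∣ c) (hx : ∀ i, C (v i) = (pencilOf A₀ A₁).mulVec x i)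
    (hy : ∀ i, c * C (v i) = (pencilOf A₁ A₀).mulVec y i) : v = 0 := by
  obtain ⟨N, hN⟩ : ∃ N, ∀ i, (x i).natDegree ≤ N :=
    ⟨Finset.univ.sup fun i => (x i).natDegree, fun i =>
      Finset.le_sup (f := fun i => (x i).natDegree) (Finset.mem_univ i)⟩
  have h1 : (pencilOf A₁ A₀).mulVec (c • fun j => (x j).reflect N) =
      (pencilOf A₁ A₀).mulVec ((X : F[X]) ^ (1 + N) • y) := by
    rw [Matrix.mulVec_smul, Matrix.mulVec_smul]
    ext1 i
    rw [Pi.smul_apply, Pi.smul_apply, ← reflect_pencilOf_mulVec _ _ hN, ← hx, ← hy, reflect_C,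
      smul_eq_mul, smul_eq_mul]
    ring
  have h2 := Matrix.mulVec_injective_of_det_ne_zero h h1
  have h3 : ∀ i, x i = 0 := by
    intro i
    have h4 := congrFun h2 i
    rw [Pi.smul_apply, Pi.smul_apply, smul_eq_mul, smul_eq_mul] at h4
    have hrel : IsRelPrime ((X : F[X]) ^ (1 + N)) c :=
      ((prime_X (R := F)).irreducible.isRelPrime_iff_not_dvd.2 hc).pow_left
    have h5 : (X : F[X]) ^ (1 + N) ∣ (x i).reflect N :=
      hrel.dvd_of_dvd_mul_left ⟨y i, h4⟩
    rw [X_pow_dvd_iff] at h5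
    rw [← reflect_eq_zero_iff (N := N)]
    ext k
    rcases lt_or_ge k (1 + N) with hk | hk
    · exact (h5 k hk).trans (coeff_zero k).symm
    · rw [coeff_reflect, revAt_eq_self_of_lt (by omega), coeff_zero]
      exact coeff_eq_zero_of_natDegree_lt ((hN i).trans_lt (by omega))
  funext i
  have := hx i
  rw [show x = 0 from funext h3, Matrix.mulVec_zero] at this
  simpa using this
end

section
variable {F : Type*} [Field F]

/-- Constant vectors of polynomials. -/
noncomputable def constVec (F : Type*) [Field F] (n : ℕ) : (Fin n → F) →ₗ[F] (Fin n → F[X]) :=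
  (Algebra.linearMap F F[X]).compLeft (Fin n)

theorem constVec_apply {n : ℕ} (v : Fin n → F) (i : Fin n) : constVec F n v i = C (v i) := rfl

theorem pencilOf_mulVec_constVec {n : ℕ} (A₀ A₁ : Matrix (Fin n) (Fin n) F) (v : Fin n → F) :
    (pencilOf A₀ A₁).mulVec (constVec F n v) =
      constVec F n (A₀.mulVec v) + (X : F[X]) • constVec F n (A₁.mulVec v) := by
  funext i
  simp only [pencilOf, Matrix.mulVec, dotProduct, Pi.add_apply, Pi.smul_apply, constVec_apply,
    Matrix.add_apply, Matrix.map_apply, Matrix.smul_apply, smul_eq_mul, map_sum, Finset.mul_sum,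
    map_mul, ← Finset.sum_add_distrib]
  exact Finset.sum_congr rfl fun j _ => by ring

theorem eq_zero_of_mulVec_pair {n : ℕ} {A₀ A₁ : Matrix (Fin n) (Fin n) F}
    (h : (pencilOf A₀ A₁).det ≠ 0) {v : Fin n → F} (h0 : A₀.mulVec v = 0)
    (h1 : A₁.mulVec v = 0) : v = 0 := by
  have := pencilOf_mulVec_constVec A₀ A₁ v
  rw [h0, h1, map_zero, smul_zero, add_zero] at this
  have h2 := Matrix.eq_zero_of_mulVec_eq_zero h this
  funext i
  exact C_eq_zero.1 (congrFun h2 i)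

theorem exists_weierstrass {n : ℕ} {A₀ A₁ : Matrix (Fin n) (Fin n) F}
    (hA : (homPencil A₀ A₁).det ≠ 0) {φ : ℕ → MvPolynomial (Fin 2) F}
    (hφ : IsHomogeneousIF A₀ A₁ φ) {e : ℕ → ℕ}
    (he : ∀ i < n, ∀ k, MvPolynomial.X 1 ^ k ∣ φ i ↔ k ≤ e i) :
    ∑ i ∈ Finset.range n, (dehom (φ i)).natDegree + ∑ i ∈ Finset.range n, e i = n ∧
    ∃ θ η : (Fin n → F) ≃ₗ[F] (TorsionModule (fun i : Fin n => dehom (φ i)) ×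
        TorsionModule (fun i : Fin n => (X : F[X]) ^ e i)),
      (∀ v, θ (A₀.mulVec v) = (-((X : F[X]) • (η v).1), (η v).2)) ∧
      ∀ v, θ (A₁.mulVec v) = ((η v).1, -((X : F[X]) • (η v).2)) := by
  have hA' : (homPencil A₁ A₀).det ≠ 0 := by simpa using det_homPencil_chart 0 hA
  have hp := (det_pencilOf_ne_zero_iff _ _).2 hA
  have hp' := (det_pencilOf_ne_zero_iff _ _).2 hA'
  have hφ' : IsHomogeneousIF A₁ A₀ fun i => chartEquiv 0 (φ i) := by simpa using hφ.chart 0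
  have hdvd : ∏ i ∈ Finset.range n, φ i ∣ (homPencil A₀ A₁).det :=
    (hφ n le_rfl).1 _ (det_mem_minorsSet _)
  have hdvd1 : ∀ i < n, φ i ∣ (homPencil A₀ A₁).det := fun i hi => dvd_det_of_isGCDOf hφ hi
  have hdvd' : ∀ i < n, chartEquiv 0 (φ i) ∣ (homPencil A₁ A₀).det := fun i hi =>
    dvd_det_of_isGCDOf hφ' hi
  have hhom := isHomogeneous_of_mem_minorsSet (det_mem_minorsSet (homPencil A₀ A₁))
  have hhom' := isHomogeneous_of_mem_minorsSet (det_mem_minorsSet (homPencil A₁ A₀))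
  have hk : ∀ i < n, ∀ k, (X : F[X]) ^ k ∣ dehom (chartEquiv 0 (φ i)) ↔ k ≤ e i := by
    intro i hi k
    rw [← X_zero_pow_dvd_iff_of_dvd hhom' hA' (hdvd' i hi), ← he i hi, ← chartEquiv_X_one 0,
      ← map_pow]
    exact map_dvd_iff (chartEquiv 0)
  have hne : ∀ i < n, dehom (φ i) ≠ 0 := fun i hi =>
    ne_zero_of_dvd_ne_zero (dehom_ne_zero hhom hA) (dehom_dvd (hdvd1 i hi))
  have hex : ∀ i : Fin n, ∃ d : F[X], dehom (chartEquiv 0 (φ i)) = X ^ e i * d ∧ ¬ X ∣ d := by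
    intro i
    obtain ⟨d, hd⟩ := (hk i i.2 (e i)).2 le_rfl
    refine ⟨d, hd, fun hX => ?_⟩
    have := (hk i i.2 (e i + 1)).1 (by rw [hd, pow_succ]; exact mul_dvd_mul_left _ hX)
    omega
  choose d hd hd' using hex
  have hc : ¬ X ∣ ∏ i, d i := fun h => by
    obtain ⟨i, -, hi⟩ := (prime_X (R := F)).exists_mem_finset_dvd h
    exact hd' i hi
  obtain ⟨qf, hqf, hqf0⟩ := exists_presentation_of_isGCDOf hp (hφ.isGCDOf_dehom)
  obtain ⟨qi, hqi, hqi0, hqi1⟩ := exists_presentation_of_dvd hp' (hφ'.isGCDOf_dehom)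
    (a := fun i => X ^ e i) (c := ∏ i, d i)
    (fun i => (hk i i.2 _).2 le_rfl) (fun i => by
      rw [hd, mul_comm]
      exact mul_dvd_mul_right (Finset.dvd_prod_of_mem d (Finset.mem_univ i)) _)
  have hfinf : Module.Finite F (TorsionModule (fun i : Fin n => dehom (φ i))) :=
    finite_torsionModule fun i => hne i i.2
  have hfini : Module.Finite F (TorsionModule (fun i : Fin n => (X : F[X]) ^ e i)) :=
    finite_torsionModule fun i => pow_ne_zero _ X_ne_zero
  have hrank : finrank F (TorsionModule (fun i : Fin n => dehom (φ i)) ×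
      TorsionModule (fun i : Fin n => (X : F[X]) ^ e i)) =
      ∑ i ∈ Finset.range n, (dehom (φ i)).natDegree + ∑ i ∈ Finset.range n, e i := by
    rw [Module.finrank_prod, finrank_torsionModule fun i => hne i i.2,
      finrank_torsionModule fun i => pow_ne_zero _ X_ne_zero, Finset.sum_range, Finset.sum_range]
    simp
  have hle : ∑ i ∈ Finset.range n, (dehom (φ i)).natDegree + ∑ i ∈ Finset.range n, e i ≤ n := by
    rw [← natDegree_prod _ _ fun i hi => hne i (Finset.mem_range.1 hi), ← map_prod]
    refine (Nat.add_le_add_right (natDegree_le_of_dvd (dehom_dvd hdvd)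
      (dehom_ne_zero hhom hA)) _).trans (add_le_of_pow_dvd_dehom_chartEquiv hhom hA ?_)
    refine dvd_trans ?_ (dehom_dvd (chartEquiv_dvd 0 hdvd))
    rw [← Finset.prod_pow_eq_pow_sum, map_prod, map_prod]
    exact Finset.prod_dvd_prod_of_dvd _ _ fun i hi => (hk i (Finset.mem_range.1 hi) _).2 le_rfl
  let qf' := qf.restrictScalars F ∘ₗ constVec F n
  let qi' := qi.restrictScalars F ∘ₗ constVec F n
  have hinj : Function.Injective (qf'.prod qi') := by
    rw [← LinearMap.ker_eq_bot, LinearMap.ker_eq_bot']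
    intro v hv
    obtain ⟨x, hx⟩ := (hqf0 _).1 (congrArg Prod.fst hv)
    obtain ⟨y, hy⟩ := hqi1 _ (congrArg Prod.snd hv)
    exact eq_zero_of_mem_range_charts hp' hc (fun i => congrFun hx i) fun i => congrFun hy i
  have hfin := LinearMap.finrank_le_finrank_of_injective hinj
  rw [hrank, finrank_fin_fun] at hfin
  have hfr : finrank F (Fin n → F) = finrank F (TorsionModule (fun i : Fin n => dehom (φ i)) ×
      TorsionModule (fun i : Fin n => (X : F[X]) ^ e i)) := by
    rw [hrank, finrank_fin_fun]
    omega
  refine ⟨by omega, ?_⟩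
  have hf0 : ∀ v, qf' (A₀.mulVec v) = -((X : F[X]) • qf' (A₁.mulVec v)) := by
    intro v
    have := (hqf0 _).2 ⟨constVec F n v, rfl⟩
    rw [pencilOf_mulVec_constVec, map_add, map_smul] at this
    exact eq_neg_of_add_eq_zero_left this
  have hi1 : ∀ v, qi' (A₁.mulVec v) = -((X : F[X]) • qi' (A₀.mulVec v)) := by
    intro v
    have := hqi0 (constVec F n v)
    rw [pencilOf_mulVec_constVec, map_add, map_smul] at this
    exact eq_neg_of_add_eq_zero_left this
  let η := (qf' ∘ₗ A₁.mulVecLin).prod (qi' ∘ₗ A₀.mulVecLin)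
  have hη : Function.Injective η := by
    rw [← LinearMap.ker_eq_bot, LinearMap.ker_eq_bot']
    intro v hv
    have h1 : qf' (A₁.mulVec v) = 0 := congrArg Prod.fst hv
    have h2 : qi' (A₀.mulVec v) = 0 := congrArg Prod.snd hv
    refine eq_zero_of_mulVec_pair hp (hinj ?_) (hinj ?_)
    · rw [map_zero]
      exact Prod.ext (by rw [LinearMap.prod_apply]; exact (hf0 v).trans (by
        rw [h1, smul_zero, neg_zero]; rfl)) h2
    · rw [map_zero]
      exact Prod.ext h1 (by rw [LinearMap.prod_apply]; exact (hi1 v).trans (by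
        rw [h2, smul_zero, neg_zero]; rfl))
  refine ⟨LinearEquiv.ofBijective (qf'.prod qi') ⟨hinj,
      (LinearMap.injective_iff_surjective_of_finrank_eq_finrank hfr).1 hinj⟩,
    LinearEquiv.ofBijective η ⟨hη,
      (LinearMap.injective_iff_surjective_of_finrank_eq_finrank hfr).1 hη⟩, fun v => ?_, fun
        v => ?_⟩
  · exact Prod.ext (hf0 v) rfl
  · exact Prod.ext rfl (hi1 v)
end

theorem exists_forall_pow_dvd_iff_le {R : Type*} [CommRing R] [IsDomain R] [WfDvdMonoid R] {p a : R}
    (hp : Prime p) (ha : a ≠ 0) : ∃ e : ℕ, ∀ k, p ^ k ∣ a ↔ k ≤ e := by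
  have h := FiniteMultiplicity.of_prime_left hp ha
  exact ⟨_, fun k => h.pow_dvd_iff_le_multiplicity⟩

theorem extIF_natCast_add_one {R : Type*} [CommRing R] {n : ℕ} (f : ℕ → R) {i : ℕ} (hi : i < n) :
    extIF n f ((i : ℤ) + 1) = f i := by
  rw [extIF, if_neg (by omega), if_neg (by omega)]
  simp

theorem extIF_of_lt_one {R : Type*} [CommRing R] {n : ℕ} (f : ℕ → R) {j : ℤ} (hj : j < 1) :
    extIF n f j = 1 := if_pos hj

theorem extIF_of_lt {R : Type*} [CommRing R] {n : ℕ} (f : ℕ → R) {j : ℤ} (hj : (n : ℤ) < j) :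
    extIF n f j = 0 := by
  rw [extIF, if_neg (by omega), if_pos hj]

section
variable {F : Type*} [Field F]

theorem isDvdChain_extIF {n : ℕ} {f : ℕ → F[X]} (h0 : ∀ i < n, f i ≠ 0)
    (hd : ∀ i, i + 1 < n → f i ∣ f (i + 1)) : IsDvdChain n (extIF n f) where
  isUnit j hj := by
    rw [extIF_of_lt_one _ (by omega)]
    exact isUnit_one
  eq_zero j hj := extIF_of_lt _ hj
  ne_zero j hj := by
    rcases lt_or_ge j 1 with h | h
    · rw [extIF_of_lt_one _ h]
      exact one_ne_zero
    · obtain ⟨i, rfl⟩ : ∃ i : ℕ, j = i + 1 := ⟨(j - 1).toNat, by omega⟩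
      rw [extIF_natCast_add_one _ (by omega)]
      exact h0 _ (by omega)
  dvd i j hij := by
    rcases lt_or_ge i 1 with h | h
    · rw [extIF_of_lt_one _ h]
      exact one_dvd _
    rcases lt_or_ge (n : ℤ) j with h' | h'
    · rw [extIF_of_lt _ h']
      exact dvd_zero _
    obtain ⟨a, rfl⟩ : ∃ a : ℕ, i = a + 1 := ⟨(i - 1).toNat, by omega⟩
    obtain ⟨b, hb⟩ := Nat.exists_eq_add_of_le (show a ≤ (j - 1).toNat by omega)
    obtain rfl : j = ((a + b : ℕ) : ℤ) + 1 := by omega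
    rw [extIF_natCast_add_one _ (by omega), extIF_natCast_add_one _ (by omega)]
    clear hij h hb
    induction b with
    | zero => exact dvd_rfl
    | succ b ih => exact (ih (by omega)).trans (hd _ (by omega))

theorem dehom_extIF {n : ℕ} (φ : ℕ → MvPolynomial (Fin 2) F) (j : ℤ) :
    dehom (extIF n φ j) = extIF n (fun i => dehom (φ i)) j := by
  unfold extIF
  split_ifs <;> simp

theorem Interlace.chainInterlace {n r : ℕ} {φ ψ : ℕ → MvPolynomial (Fin 2) F}
    (h : Interlace n r φ ψ) :
    ChainInterlace r (extIF n fun i => dehom (φ i)) (extIF n fun i => dehom (ψ i)) := by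
  intro j
  constructor
  · rcases lt_or_ge j 1 with h1 | h1
    · rw [extIF_of_lt_one _ (by omega)]
      exact one_dvd _
    rcases lt_or_ge (n : ℤ) j with h2 | h2
    · rw [extIF_of_lt (fun i => dehom (ψ i)) h2]
      exact dvd_zero _
    obtain ⟨i, rfl⟩ : ∃ i : ℕ, j = i := ⟨j.toNat, by omega⟩
    rw [← dehom_extIF, ← dehom_extIF]
    exact dehom_dvd (h i (by omega) (by omega)).1
  · rcases lt_or_ge (j - r) 1 with h1 | h1
    · rw [extIF_of_lt_one _ h1]
      exact one_dvd _
    rcases lt_or_ge (n : ℤ) (j - r) with h2 | h2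
    · rw [extIF_of_lt (fun i => dehom (φ i)) (j := j) (by omega)]
      exact dvd_zero _
    obtain ⟨i, hi⟩ : ∃ i : ℕ, j - r = i := ⟨(j - r).toNat, by omega⟩
    obtain rfl : j = i + r := by omega
    rw [← dehom_extIF, ← dehom_extIF, hi]
    exact dehom_dvd (h i (by omega) (by omega)).2

theorem rank_le_of_mulVec_eq {n r : ℕ} {P : Matrix (Fin n) (Fin n) F}
    {f : (Fin n → F) →ₗ[F] (Fin n → F)} (h : ∀ v, P.mulVec v = f v) (hf : f.rank ≤ r) :
    P.rank ≤ r := by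
  have : P.mulVecLin = f := LinearMap.ext h
  rw [Matrix.rank, this]
  exact finrank_le_of_rank_le hf

theorem exists_constant_perturbation {n r : ℕ} (hn : 0 < n) {A₀ A₁ B₀ B₁ : Matrix (Fin n) (Fin n) F}
    (hA : (homPencil A₀ A₁).det ≠ 0) (hB : (homPencil B₀ B₁).det ≠ 0)
    {φ ψ : ℕ → MvPolynomial (Fin 2) F}
    (hφ : IsHomogeneousIF A₀ A₁ φ) (hφc : ∀ i, i + 1 < n → φ i ∣ φ (i + 1))
    (hψ : IsHomogeneousIF B₀ B₁ ψ) (hψc : ∀ i, i + 1 < n → ψ i ∣ ψ (i + 1))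
    (hmult : ∀ i < n, ∀ k : ℕ, MvPolynomial.X 1 ^ k ∣ φ i ↔ MvPolynomial.X 1 ^ k ∣ ψ i)
    (hI : Interlace n r φ ψ) :
    ∃ Q R P : Matrix (Fin n) (Fin n) F, IsUnit Q.det ∧ IsUnit R.det ∧ P.rank ≤ r ∧
      A₀ + P = Q * B₀ * R ∧ A₁ = Q * B₁ * R := by
  have hφ0 : ∀ i < n, φ i ≠ 0 := fun i hi => ne_zero_of_dvd_ne_zero hA (dvd_det_of_isGCDOf hφ hi)
  have hψ0 : ∀ i < n, ψ i ≠ 0 := fun i hi => ne_zero_of_dvd_ne_zero hB (dvd_det_of_isGCDOf hψ hi)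
  have hφ1 : ∀ i < n, dehom (φ i) ≠ 0 := fun i hi => ne_zero_of_dvd_ne_zero
    (dehom_ne_zero (isHomogeneous_of_mem_minorsSet (det_mem_minorsSet _)) hA)
    (dehom_dvd (dvd_det_of_isGCDOf hφ hi))
  have hψ1 : ∀ i < n, dehom (ψ i) ≠ 0 := fun i hi => ne_zero_of_dvd_ne_zero
    (dehom_ne_zero (isHomogeneous_of_mem_minorsSet (det_mem_minorsSet _)) hB)
    (dehom_dvd (dvd_det_of_isGCDOf hψ hi))
  have hex : ∀ i, ∃ e : ℕ, i < n → ∀ k, MvPolynomial.X 1 ^ k ∣ φ i ↔ k ≤ e := by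
    intro i
    by_cases hi : i < n
    · obtain ⟨e, he⟩ := exists_forall_pow_dvd_iff_le
        (MvPolynomial.X_prime (R := F) (i := (1 : Fin 2))) (hφ0 i hi)
      exact ⟨e, fun _ => he⟩
    · exact ⟨0, fun h => absurd h hi⟩
  choose e he using hex
  obtain ⟨hsA, θA, ηA, hA0, hA1⟩ := exists_weierstrass hA hφ he
  obtain ⟨hsB, θB, ηB, hB0, hB1⟩ := exists_weierstrass hB hψ (e := e)
    fun i hi k => (hmult i hi k).symm.trans (he i hi k)
  have hT := rankSimilar_of_chainInterlace hn r
    (isDvdChain_extIF hφ1 fun i hi => dehom_dvd (hφc i hi))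
    (isDvdChain_extIF hψ1 fun i hi => dehom_dvd (hψc i hi)) hI.chainInterlace (by
      have e1 : ∀ f : ℕ → F[X], ∑ i ∈ Finset.range n, (extIF n f ((i : ℤ) + 1)).natDegree =
          ∑ i ∈ Finset.range n, (f i).natDegree := fun f =>
        Finset.sum_congr rfl fun i hi => by rw [extIF_natCast_add_one _ (Finset.mem_range.1 hi)]
      rw [e1, e1]
      omega)
  have e2 : ∀ f : ℕ → F[X], (fun i : Fin n => extIF n f ((i : ℤ) + 1)) = fun i : Fin n => f i :=
    fun f => funext fun i => extIF_natCast_add_one _ i.2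
  rw [e2, e2] at hT
  unfold RankSimilar at hT
  obtain ⟨T, hT⟩ := hT
  let I := LinearEquiv.refl F (TorsionModule (fun i : Fin n => (X : F[X]) ^ e i))
  let q := θB.trans ((T.symm.prodCongr I).trans θA.symm)
  let ρ := ηA.trans ((T.prodCongr I).trans ηB.symm)
  have hq : ∀ v, θA (q v) = (T.symm (θB v).1, (θB v).2) := fun v => by simp [q, I]
  have hρ : ∀ v, ηB (ρ v) = (T (ηA v).1, (ηA v).2) := fun v => by simp [ρ, I]
  let Q := LinearMap.toMatrix' (q : (Fin n → F) →ₗ[F] (Fin n → F))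
  let R := LinearMap.toMatrix' (ρ : (Fin n → F) →ₗ[F] (Fin n → F))
  have hQ : ∀ v, Q.mulVec v = q v := fun v => LinearMap.toMatrix'_mulVec _ v
  have hR : ∀ v, R.mulVec v = ρ v := fun v => LinearMap.toMatrix'_mulVec _ v
  refine ⟨Q, R, Q * B₀ * R - A₀, ?_, ?_, ?_, by abel, ?_⟩
  · rw [LinearMap.det_toMatrix']
    exact q.isUnit_det'
  · rw [LinearMap.det_toMatrix']
    exact ρ.isUnit_det'
  · refine rank_le_of_mulVec_eq (f := θA.symm.toLinearMap ∘ₗ (LinearMap.inl F _ _ ∘ₗ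
      (T.symm.toLinearMap ∘ₗ (commX T.toLinearMap ∘ₗ (LinearMap.fst F _ _ ∘ₗ ηA.toLinearMap)))))
        (fun v => ?_) ?_
    · apply θA.injective
      rw [Matrix.sub_mulVec, map_sub, ← Matrix.mulVec_mulVec, ← Matrix.mulVec_mulVec, hQ, hR, hq,
        hB0, hρ, hA0]
      refine Eq.trans ?_ (θA.apply_symm_apply
        (T.symm (commX T.toLinearMap (ηA v).1), 0)).symm
      refine Prod.ext ?_ (sub_self _)
      change T.symm (-((X : F[X]) • T (ηA v).1)) - -((X : F[X]) • (ηA v).1) =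
        T.symm (T ((X : F[X]) • (ηA v).1) - (X : F[X]) • T (ηA v).1)
      rw [map_neg, map_sub, T.symm_apply_apply]
      abel
    · exact (LinearMap.rank_comp_le_right _ _).trans <| (LinearMap.rank_comp_le_right _ _).trans <|
        (LinearMap.rank_comp_le_right _ _).trans <| (LinearMap.rank_comp_le_left _ _).trans hT
  · refine Matrix.toLin'.injective (LinearMap.ext fun v => θA.injective ?_)
    rw [Matrix.toLin'_apply, Matrix.toLin'_apply, ← Matrix.mulVec_mulVec, ← Matrix.mulVec_mulVec,
      hQ, hR, hq, hB1, hρ, hA1]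
    simp
end

section
variable {F : Type*} [Field F]

theorem exists_rank_factorization {K : Type*} [Field K] {m n : ℕ} (M : Matrix (Fin m) (Fin n) K) :
    ∃ (B : Matrix (Fin m) (Fin M.rank) K) (C : Matrix (Fin M.rank) (Fin n) K), M = B * C := by
  let b : Basis (Fin M.rank) K (LinearMap.range M.mulVecLin) := finBasis K _
  refine ⟨LinearMap.toMatrix' ((LinearMap.range M.mulVecLin).subtype ∘ₗ
    b.equivFun.symm.toLinearMap), LinearMap.toMatrix' (b.equivFun.toLinearMap ∘ₗ
      M.mulVecLin.rangeRestrict), ?_⟩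
  rw [← LinearMap.toMatrix'_comp, ← Matrix.toLin'.injective.eq_iff, Matrix.toLin'_toMatrix']
  refine LinearMap.ext fun v => ?_
  simp

theorem matrix_rank_map_le {K S : Type*} [Field K] [CommRing S] [Nontrivial S] {m n : ℕ}
    (f : K →+* S)
    (M : Matrix (Fin m) (Fin n) K) : (M.map f).rank ≤ M.rank := by
  obtain ⟨B, C, h⟩ := exists_rank_factorization M
  calc (M.map f).rank = (B.map f * C.map f).rank := by rw [← Matrix.map_mul, ← h]
    _ ≤ (B.map f).rank := Matrix.rank_mul_le_left _ _
    _ ≤ M.rank := Matrix.rank_le_width _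

theorem normalRank_pencilOf_smul_le {n : ℕ} (a b : F) (P : Matrix (Fin n) (Fin n) F) :
    normalRank (pencilOf (a • P) (b • P)) ≤ P.rank := by
  let f : F →+* RatFunc F := (algebraMap F[X] (RatFunc F)).comp C
  have e : (pencilOf (a • P) (b • P)).map (algebraMap F[X] (RatFunc F)) =
      (algebraMap F[X] (RatFunc F) (C a + X * C b)) • P.map f := by
    refine Matrix.ext fun i j => ?_
    simp [pencilOf, f]
    ring
  rw [normalRank, e]
  refine le_trans ?_ (matrix_rank_map_le f P)
  rw [Matrix.smul_eq_diagonal_mul]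
  exact Matrix.rank_mul_le_right _ _

theorem chartEquiv_extIF (a : F) {n : ℕ} (φ : ℕ → MvPolynomial (Fin 2) F) (j : ℤ) :
    chartEquiv a (extIF n φ j) = extIF n (fun i => chartEquiv a (φ i)) j := by
  unfold extIF
  split_ifs <;> simp

theorem Interlace.chart (a : F) {n r : ℕ} {φ ψ : ℕ → MvPolynomial (Fin 2) F}
    (h : Interlace n r φ ψ) :
    Interlace n r (fun i => chartEquiv a (φ i)) fun i => chartEquiv a (ψ i) := by
  intro i h1 h2
  rw [← chartEquiv_extIF, ← chartEquiv_extIF, ← chartEquiv_extIF]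
  exact ⟨chartEquiv_dvd a (h i h1 h2).1, chartEquiv_dvd a (h i h1 h2).2⟩

theorem chartEquiv_dvd_iff (a : F) {p q : MvPolynomial (Fin 2) F} :
    chartEquiv a p ∣ chartEquiv a q ↔ p ∣ q := by
  refine ⟨fun ⟨c, hc⟩ => ⟨(chartEquiv a).symm c, (chartEquiv a).injective ?_⟩, chartEquiv_dvd a⟩
  rw [map_mul, AlgEquiv.apply_symm_apply, hc]

theorem chartEquiv_linear (a : F) : chartEquiv a (MvPolynomial.X 0 -
    MvPolynomial.C a * MvPolynomial.X 1) = MvPolynomial.X 1 := by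
  rw [map_sub, map_mul]
  simp

theorem mul_pencilOf_mul {n : ℕ} (Q R G₀ G₁ : Matrix (Fin n) (Fin n) F) :
    Q.map C * pencilOf G₀ G₁ * R.map C = pencilOf (Q * G₀ * R) (Q * G₁ * R) := by
  simp only [pencilOf, mul_add, add_mul, Matrix.mul_smul, Matrix.smul_mul, Matrix.map_mul]

theorem exists_normalRank_sub_le {n r : ℕ} (hn : 0 < n) {A₀ A₁ B₀ B₁ : Matrix (Fin n) (Fin n) F}
    (hA : (homPencil A₀ A₁).det ≠ 0) (hB : (homPencil B₀ B₁).det ≠ 0)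
    {φ ψ : ℕ → MvPolynomial (Fin 2) F}
    (hφ : IsHomogeneousIF A₀ A₁ φ) (hφc : ∀ i, i + 1 < n → φ i ∣ φ (i + 1))
    (hψ : IsHomogeneousIF B₀ B₁ ψ) (hψc : ∀ i, i + 1 < n → ψ i ∣ ψ (i + 1))
    {L : MvPolynomial (Fin 2) F}
    (hL : (∃ lam : F, L = MvPolynomial.X 0 - MvPolynomial.C lam * MvPolynomial.X 1) ∨
      L = MvPolynomial.X 1)
    (hmult : ∀ i < n, ∀ k : ℕ, L ^ k ∣ φ i ↔ L ^ k ∣ ψ i)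
    (hI : Interlace n r φ ψ) :
    ∃ Q R : Matrix (Fin n) (Fin n) F, IsUnit Q.det ∧ IsUnit R.det ∧
      normalRank (Q.map C * pencilOf B₀ B₁ * R.map C - pencilOf A₀ A₁) ≤ r := by
  have key : ∃ (Q R P : Matrix (Fin n) (Fin n) F) (a b : F), IsUnit Q.det ∧ IsUnit R.det ∧
      P.rank ≤ r ∧ A₀ + a • P = Q * B₀ * R ∧ A₁ + b • P = Q * B₁ * R := by
    rcases hL with ⟨a, rfl⟩ | rfl
    · obtain ⟨Q, R, P, hQ, hR, hP, h1, h2⟩ := exists_constant_perturbation hn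
        (det_homPencil_chart a hA) (det_homPencil_chart a hB) (hφ.chart a)
        (fun i hi => chartEquiv_dvd a (hφc i hi)) (hψ.chart a)
        (fun i hi => chartEquiv_dvd a (hψc i hi)) (fun i hi k => by
          rw [← chartEquiv_linear a, ← map_pow, chartEquiv_dvd_iff, chartEquiv_dvd_iff]
          exact hmult i hi k) (hI.chart a)
      refine ⟨Q, R, P, -a, 1, hQ, hR, hP, ?_, by rw [one_smul, h1]⟩
      rw [mul_add, add_mul, Matrix.mul_smul, Matrix.smul_mul, ← h1, smul_add] at h2
      rw [neg_smul, ← sub_eq_add_neg, sub_eq_iff_eq_add, ← add_left_inj (a • A₁), h2]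
      abel
    · obtain ⟨Q, R, P, hQ, hR, hP, h1, h2⟩ :=
        exists_constant_perturbation hn hA hB hφ hφc hψ hψc hmult hI
      exact ⟨Q, R, P, 1, 0, hQ, hR, hP, by rw [one_smul, h1], by rw [zero_smul, add_zero, h2]⟩
  obtain ⟨Q, R, P, a, b, hQ, hR, hP, h0, h1⟩ := key
  refine ⟨Q, R, hQ, hR, ?_⟩
  have e : Q.map C * pencilOf B₀ B₁ * R.map C - pencilOf A₀ A₁ = pencilOf (a • P) (b • P) := by
    rw [← eq_sub_iff_add_eq'] at h0 h1
    rw [h0, h1, mul_pencilOf_mul]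
    refine Matrix.ext fun i j => ?_
    simp only [pencilOf, Matrix.sub_apply, Matrix.add_apply, Matrix.smul_apply, Matrix.map_apply,
      map_sub, smul_eq_mul]
    ring
  rw [e]
  exact (normalRank_pencilOf_smul_le a b P).trans hP
end

section
variable {F : Type*} [Field F]

theorem det_one_add_vecMulVec {R : Type*} [CommRing R] {n : ℕ} (u v : Fin n → R) :
    (1 + Matrix.vecMulVec u v).det = 1 + v ⬝ᵥ u := by
  rw [Matrix.vecMulVec_eq Unit, Matrix.det_one_add_replicateCol_mul_replicateRow]

theorem rank_add_vecMulVec_le {K : Type*} [Field K] {n : ℕ} (D : Matrix (Fin n) (Fin n) K)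
    (u v : Fin n → K) : (D + Matrix.vecMulVec u v).rank ≤ D.rank + 1 :=
  calc (D + Matrix.vecMulVec u v).rank
    _ ≤ finrank K ↥(LinearMap.range D.mulVecLin ⊔
          LinearMap.range (Matrix.vecMulVec u v).mulVecLin) := by
      rw [Matrix.rank, Matrix.mulVecLin_add]
      exact Submodule.finrank_mono (LinearMap.range_add_le _ _)
    _ ≤ D.rank + (Matrix.vecMulVec u v).rank := Submodule.finrank_add_le_finrank_add_finrank _ _
    _ ≤ D.rank + 1 := by
      gcongr
      exact Matrix.rank_vecMulVec_le u v

theorem lt_rank_add_vecMulVec {K : Type*} [Field K] {n : ℕ} {D : Matrix (Fin n) (Fin n) K}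
    {u v x : Fin n → K} (hu : u ∉ LinearMap.range D.mulVecLin) (hx : D.mulVec x = 0)
    (hv : v ⬝ᵥ x ≠ 0) : D.rank < (D + Matrix.vecMulVec u v).rank := by
  have hlt : LinearMap.ker (D + Matrix.vecMulVec u v).mulVecLin < LinearMap.ker D.mulVecLin := by
    have hmul : ∀ y, (D + Matrix.vecMulVec u v).mulVec y = D.mulVec y + (v ⬝ᵥ y) • u := fun y => by
      rw [Matrix.add_mulVec, Matrix.vecMulVec_mulVec]
      congr 1
      ext i
      simp [mul_comm]
    refine lt_of_le_not_ge (fun y hy => ?_) fun h => ?_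
    · rw [LinearMap.mem_ker, Matrix.mulVecLin_apply, hmul] at hy
      rw [LinearMap.mem_ker, Matrix.mulVecLin_apply]
      by_cases h0 : v ⬝ᵥ y = 0
      · rwa [h0, zero_smul, add_zero] at hy
      · refine absurd ⟨-(v ⬝ᵥ y)⁻¹ • y, ?_⟩ hu
        rw [map_smul, Matrix.mulVecLin_apply, eq_neg_of_add_eq_zero_left hy, smul_neg, neg_smul,
          neg_neg, inv_smul_smul₀ h0]
    · have := h (LinearMap.mem_ker.2 hx)
      rw [LinearMap.mem_ker, Matrix.mulVecLin_apply, hmul, hx, zero_add] at this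
      rcases smul_eq_zero.1 this with h0 | rfl
      · exact hv h0
      · exact hu (zero_mem _)
  have := Submodule.finrank_lt_finrank_of_lt hlt
  have h1 := LinearMap.finrank_range_add_finrank_ker D.mulVecLin
  have h2 := LinearMap.finrank_range_add_finrank_ker (D + Matrix.vecMulVec u v).mulVecLin
  rw [Matrix.rank, Matrix.rank]
  omega

/-- Two proper subspaces can be avoided by a pair of vectors whose pairing is not `-1`. -/
theorem exists_notMem_notMem_one_add_dotProduct_ne_zero {n : ℕ} (hn : 2 ≤ n)
    {U V : Submodule F (Fin n → F)} (hU : U ≠ ⊤) (hV : V ≠ ⊤) :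
    ∃ u v, u ∉ U ∧ v ∉ V ∧ 1 + v ⬝ᵥ u ≠ 0 := by
  by_contra! h
  have aux : ∀ {W W' : Submodule F (Fin n → F)}, W ≠ ⊤ → W' ≠ ⊤ →
      (∀ u v, u ∉ W → v ∉ W' → 1 + v ⬝ᵥ u = 0) → W = ⊥ := by
    intro W W' hW hW' h
    obtain ⟨u, -, hu⟩ := SetLike.exists_of_lt (lt_top_iff_ne_top.2 hW)
    obtain ⟨v₀, -, hv₀⟩ := SetLike.exists_of_lt (lt_top_iff_ne_top.2 hW')
    rw [eq_bot_iff]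
    intro w hw
    have h1 : ∀ v ∉ W', v ⬝ᵥ w = 0 := fun v hv => by
      have e1 := h u v hu hv
      have e2 := h (u + w) v (fun h' => hu ((Submodule.add_mem_iff_left _ hw).1 h')) hv
      rw [dotProduct_add, ← add_assoc, e1, zero_add] at e2
      exact e2
    refine (Submodule.mem_bot F).2 (dotProduct_eq_zero_iff.1 fun v => ?_)
    rw [dotProduct_comm]
    by_cases hv : v ∈ W'
    · have := h1 (v + v₀) fun h' => hv₀ ((Submodule.add_mem_iff_right _ hv).1 h')
      rwa [add_dotProduct, h1 v₀ hv₀, add_zero] at this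
    · exact h1 v hv
  obtain rfl := aux hU hV h
  obtain rfl := aux hV hU fun u v hu hv => by rw [dotProduct_comm]; exact h v u hv hu
  have := h (Pi.single ⟨0, by omega⟩ 1) (Pi.single ⟨1, by omega⟩ 1) (by simp) (by simp)
  simp at this

/-- The rank of `M - A` can be raised by one by left multiplication of `M` with a constant
matrix of the form `1 + u vᵀ`. -/
theorem exists_rank_sub_eq_add_one {K : Type*} [Field K] [Algebra F K] {n : ℕ} (hn : 2 ≤ n)
    {M A : Matrix (Fin n) (Fin n) K} (hM : M.det ≠ 0) (hr : (M - A).rank < n) :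
    ∃ Q : Matrix (Fin n) (Fin n) F, IsUnit Q.det ∧
      (Q.map (algebraMap F K) * M - A).rank = (M - A).rank + 1 := by
  set D := M - A with hD
  have hfin : finrank K (Fin n → K) = n := by simp
  have hrange : LinearMap.range D.mulVecLin ≠ ⊤ := fun h => by
    rw [Matrix.rank, h, finrank_top, hfin] at hr
    exact lt_irrefl _ hr
  have hker : LinearMap.ker D.mulVecLin ≠ ⊥ := fun h => by
    have := LinearMap.finrank_range_add_finrank_ker D.mulVecLin
    rw [h, finrank_bot, hfin] at this
    rw [Matrix.rank] at hr
    omega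
  obtain ⟨x, hx, hx0⟩ := (Submodule.ne_bot_iff _).1 hker
  have hMx : M.mulVec x ≠ 0 := fun h => hx0 (Matrix.eq_zero_of_mulVec_eq_zero hM h)
  let ι : (Fin n → F) →ₗ[F] (Fin n → K) := (Algebra.linearMap F K).compLeft (Fin n)
  have hι : ∀ u i, ι u i = algebraMap F K (u i) := fun _ _ => rfl
  have hsingle : ∀ i, ι (Pi.single i 1) = Pi.single i 1 := fun i => by
    ext j
    rw [hι]
    rcases eq_or_ne j i with rfl | h
    · simp
    · simp [h]
  let U : Submodule F (Fin n → F) := ((LinearMap.range D.mulVecLin).restrictScalars F).comap ι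
  let V : Submodule F (Fin n → F) :=
    { carrier := {v | ι v ⬝ᵥ M.mulVec x = 0}
      add_mem' := fun {a b} ha hb => by
        rw [Set.mem_ofPred_eq] at ha hb ⊢
        rw [map_add, add_dotProduct, ha, hb, add_zero]
      zero_mem' := by
        rw [Set.mem_ofPred_eq, map_zero, zero_dotProduct]
      smul_mem' := fun c a ha => by
        rw [Set.mem_ofPred_eq] at ha ⊢
        rw [map_smul, smul_dotProduct, ha, smul_zero] }
  have hU : U ≠ ⊤ := fun h => hrange <| by
    rw [eq_top_iff, ← (Pi.basisFun K (Fin n)).span_eq, Submodule.span_le]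
    rintro _ ⟨i, rfl⟩
    have : Pi.single i 1 ∈ U := h ▸ Submodule.mem_top
    rw [Pi.basisFun_apply, ← hsingle]
    exact this
  have hV : V ≠ ⊤ := fun h => hMx <| by
    ext i
    have : ι (Pi.single i 1) ⬝ᵥ M.mulVec x = 0 := show Pi.single i 1 ∈ V from h ▸ Submodule.mem_top
    rwa [hsingle, single_one_dotProduct] at this
  obtain ⟨u, v, hu, hv, huv⟩ := exists_notMem_notMem_one_add_dotProduct_ne_zero hn hU hV
  refine ⟨1 + Matrix.vecMulVec u v, ?_, ?_⟩
  · rw [det_one_add_vecMulVec]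
    exact isUnit_iff_ne_zero.2 huv
  have e : (1 + Matrix.vecMulVec u v).map (algebraMap F K) * M - A =
      D + Matrix.vecMulVec (ι u) (Matrix.vecMul (ι v) M) := by
    have : (1 + Matrix.vecMulVec u v).map (algebraMap F K) = 1 + Matrix.vecMulVec (ι u) (ι v) := by
      refine Matrix.ext fun i j => ?_
      rcases eq_or_ne i j with rfl | h
      · simp [Matrix.vecMulVec_apply, hι]
      · simp [Matrix.vecMulVec_apply, hι, h]
    rw [this, add_mul, one_mul, Matrix.vecMulVec_mul, hD]
    abel
  rw [e]
  refine le_antisymm (rank_add_vecMulVec_le _ _ _)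
    (Nat.succ_le_of_lt (lt_rank_add_vecMulVec (x := x) hu hx ?_))
  rw [← Matrix.dotProduct_mulVec]
  exact hv

theorem exists_normalRank_sub_eq {n r ρ : ℕ} (hn : 2 ≤ n) (hr : r ≤ n)
    {A M : Matrix (Fin n) (Fin n) F[X]} (hM : M.det ≠ 0) (h : normalRank (M - A) = ρ)
    (hρ : ρ ≤ r) : ∃ Q : Matrix (Fin n) (Fin n) F, IsUnit Q.det ∧
      normalRank (Q.map C * M - A) = r := by
  induction r, hρ using Nat.le_induction with
  | base => exact ⟨1, by simp, by simp [h]⟩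
  | succ r _ ih =>
    obtain ⟨Q, hQ, hQr⟩ := ih (by omega)
    let f := algebraMap F[X] (RatFunc F)
    have hf : Function.Injective f := IsFractionRing.injective F[X] (RatFunc F)
    have hsub : ∀ Q : Matrix (Fin n) (Fin n) F, (Q.map C * M - A).map f =
        Q.map (algebraMap F (RatFunc F)) * M.map f - A.map f := fun Q => by
      rw [Matrix.map_sub f (map_sub f), Matrix.map_mul]
      rfl
    unfold normalRank at hQr
    change ((Q.map C * M - A).map f).rank = r at hQr
    rw [hsub] at hQr
    have hdet : (Q.map (algebraMap F (RatFunc F)) * M.map f).det ≠ 0 := by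
      rw [Matrix.det_mul]
      refine mul_ne_zero ?_ ?_
      · have := RingHom.map_det (algebraMap F (RatFunc F)) Q
        rw [RingHom.mapMatrix_apply] at this
        rw [← this]
        exact (hQ.map _).ne_zero
      · have := RingHom.map_det f M
        rw [RingHom.mapMatrix_apply] at this
        rw [← this]
        exact (map_ne_zero_iff f hf).2 hM
    obtain ⟨Q', hQ', h'⟩ := exists_rank_sub_eq_add_one (F := F) hn hdet (by rw [hQr]; omega)
    refine ⟨Q' * Q, by rw [Matrix.det_mul]; exact hQ'.mul hQ, ?_⟩
    unfold normalRank
    change (((Q' * Q).map C * M - A).map f).rank = r + 1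
    rw [hsub, Matrix.map_mul, Matrix.mul_assoc, h', hQr]

theorem isPencil_sub {m n : ℕ} {M N : Matrix (Fin m) (Fin n) F[X]} (hM : IsPencil M)
    (hN : IsPencil N) : IsPencil (M - N) := fun i j =>
  (degree_sub_le _ _).trans (max_le (hM i j) (hN i j))

theorem isPencil_pencilOf {m n : ℕ} (G₀ G₁ : Matrix (Fin m) (Fin n) F) :
    IsPencil (pencilOf G₀ G₁) := fun i j => by
  have : pencilOf G₀ G₁ i j = C (G₁ i j) * X + C (G₀ i j) := by
    simp [pencilOf]
    ring
  rw [this]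
  exact degree_linear_le
end

end

section

open Module

section
variable {D : Type*} [CommRing D]

/-- The vectors `w i` are linearly independent modulo `p`. -/
def IndepMod (p : D) {m : ℕ} {N : Type*} [AddCommGroup N] [Module D N] (w : Fin m → N) : Prop :=
  ∀ (c : Fin m → D) (y : N), ∑ i, c i • w i = p • y → ∀ i, p ∣ c i

/-- There are at least `j` vectors, linearly independent modulo `p`, which `M` maps into the
multiples of `p ^ k`. -/
def HasKerMod (p : D) (k j : ℕ) {n : ℕ} (M : Matrix (Fin n) (Fin n) D) : Prop :=
  ∃ m, j ≤ m ∧ ∃ w : Fin m → Fin n → D, IndepMod p w ∧ ∀ i, ∃ y, M.mulVec (w i) = p ^ k • y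

theorem IndepMod.le_card {p : D} (hp : (Ideal.span {p}).IsMaximal) {m : ℕ} {ι : Type*} [Fintype ι]
    {w : Fin m → ι → D} (hw : IndepMod p w) : m ≤ Fintype.card ι := by
  let _ : Field (D ⧸ Ideal.span {p}) := Ideal.Quotient.field _
  let π := Ideal.Quotient.mk (Ideal.span {p})
  have hli : LinearIndependent (D ⧸ Ideal.span {p}) fun i a => π (w i a) := by
    rw [Fintype.linearIndependent_iff]
    intro g hg i
    choose c hc using fun i => Ideal.Quotient.mk_surjective (g i)
    have h : ∀ a, ∃ y, ∑ i, c i * w i a = p * y := fun a => by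
      have := congrFun hg a
      rw [Finset.sum_apply] at this
      simp only [Pi.smul_apply, smul_eq_mul, Pi.zero_apply, ← hc] at this
      rw [← dvd_def, ← Ideal.mem_span_singleton, ← Ideal.Quotient.eq_zero_iff_mem, map_sum, ← this]
      exact Finset.sum_congr rfl fun i _ => map_mul _ _ _
    choose y hy using h
    rw [← hc, Ideal.Quotient.eq_zero_iff_mem, Ideal.mem_span_singleton]
    refine hw c y (funext fun a => ?_) i
    rw [Finset.sum_apply]
    exact hy a
  simpa using hli.fintype_card_le_finrank

theorem hasKerMod_of_pow_dvd {p : D} {n k i₀ : ℕ} {M : Matrix (Fin n) (Fin n) D}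
    {α : ℕ → D} {b c : Basis (Fin n) D (Fin n → D)} (hM : ∀ i : Fin n, M.mulVec (b i) = α i • c i)
    (hα : ∀ i < n, i₀ ≤ i → p ^ k ∣ α i) : HasKerMod p k (n - i₀) M := by
  rcases lt_or_ge n i₀ with h | h
  · exact ⟨0, by omega, Fin.elim0, fun _ _ _ i => i.elim0, fun i => i.elim0⟩
  obtain ⟨m, rfl⟩ := Nat.exists_eq_add_of_le h
  refine ⟨m, by omega, fun i => b (Fin.natAdd i₀ i), fun g y hg i => ?_, fun i => ?_⟩
  · refine ⟨b.repr y (Fin.natAdd i₀ i), ?_⟩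
    have := congrArg (fun v => b.repr v (Fin.natAdd i₀ i)) hg
    simp only [map_sum, map_smul, Finsupp.smul_apply, smul_eq_mul, Basis.repr_self,
      Finsupp.coe_finsetSum, Finset.sum_apply, Finsupp.single_apply,
      (Fin.natAdd_injective m i₀).eq_iff, mul_ite, mul_one, mul_zero] at this
    simpa using this
  · obtain ⟨d, hd⟩ := hα (Fin.natAdd i₀ i : Fin (i₀ + m)) (by simp) (by simp)
    exact ⟨d • c (Fin.natAdd i₀ i), by rw [hM, hd, mul_smul]⟩

theorem pow_dvd_of_hasKerMod [IsDomain D] {p : D} (hp : Prime p) (hmax : (Ideal.span {p}).IsMaximal)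
    {n k i₀ : ℕ} (hi₀ : i₀ < n) {M : Matrix (Fin n) (Fin n) D} {α : ℕ → D}
    {b c : Basis (Fin n) D (Fin n → D)} (hM : ∀ i : Fin n, M.mulVec (b i) = α i • c i)
    (hα : ∀ i ≤ i₀, α i ∣ α i₀) (h : HasKerMod p k (n - i₀) M) : p ^ k ∣ α i₀ := by
  by_contra hnd
  obtain ⟨m, hm, w, hw, hy⟩ := h
  have hdvd : ∀ l (i : Fin n), (i : ℕ) ≤ i₀ → p ∣ b.repr (w l) i := by
    intro l i hi
    obtain ⟨y, hy⟩ := hy l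
    have h1 : M.mulVec (w l) = ∑ i, (b.repr (w l) i * α i) • c i := by
      conv_lhs => rw [← b.sum_repr (w l)]
      rw [← Matrix.mulVecLin_apply, map_sum]
      refine Finset.sum_congr rfl fun i _ => ?_
      rw [map_smul, Matrix.mulVecLin_apply, hM, mul_smul]
    have h2 : p ^ k ∣ b.repr (w l) i * α i := by
      have := congrArg (fun v => c.repr v i) (h1.symm.trans hy)
      rw [c.repr_sum_self] at this
      rw [this, map_smul]
      exact ⟨_, rfl⟩
    by_contra h3
    exact hnd ((hp.pow_dvd_of_dvd_mul_left k h3 h2).trans (hα i hi))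
  have hcard := IndepMod.le_card (p := p) hmax (m := m) (ι := {i : Fin n // i₀ < (i : ℕ)})
    (w := fun l i => b.repr (w l) i) fun g y hg => by
      have hall : ∀ i, p ∣ b.repr (∑ l, g l • w l) i := fun i => by
        simp only [map_sum, map_smul, Finsupp.coe_finsetSum, Finset.sum_apply, Finsupp.smul_apply,
          smul_eq_mul]
        rcases le_or_gt (i : ℕ) i₀ with hi | hi
        · exact Finset.dvd_sum fun l _ => (hdvd l i hi).mul_left _
        · have := congrFun hg ⟨i, hi⟩
          simp only [Finset.sum_apply, Pi.smul_apply, smul_eq_mul] at this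
          exact ⟨_, this⟩
      choose z hz using hall
      refine hw g (∑ i, z i • b i) ?_
      rw [← b.sum_repr (∑ l, g l • w l), Finset.smul_sum]
      refine Finset.sum_congr rfl fun i _ => ?_
      rw [hz, mul_smul]
  have : Fintype.card {i : Fin n // i₀ < (i : ℕ)} < n - i₀ := by
    rw [Fintype.card_subtype]
    have : (Finset.univ.filter fun i : Fin n => i₀ < (i : ℕ)) = Finset.Ioi ⟨i₀, hi₀⟩ := by
      ext i
      simp [Fin.lt_def]
    rw [this, Fin.card_Ioi]
    simp
    omega
  omega

theorem HasKerMod.mul_mul {p : D} {n k j : ℕ} {M Q R : Matrix (Fin n) (Fin n) D}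
    (hQ : IsUnit Q.det) (hR : IsUnit R.det) (h : HasKerMod p k j (Q * M * R)) :
    HasKerMod p k j M := by
  obtain ⟨m, hm, w, hw, hy⟩ := h
  refine ⟨m, hm, fun i => R.mulVec (w i), fun c y hc => hw c (R⁻¹.mulVec y) ?_, fun i => ?_⟩
  · have := congrArg R⁻¹.mulVec hc
    simp only [← Matrix.mulVecLin_apply, ← map_smul, ← map_sum] at this
    simp only [Matrix.mulVecLin_apply, Matrix.mulVec_mulVec, Matrix.nonsing_inv_mul R hR,
      Matrix.one_mulVec] at this
    rw [this, Matrix.mulVec_smul]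
  · obtain ⟨y, hy⟩ := hy i
    refine ⟨Q⁻¹.mulVec y, ?_⟩
    rw [← Matrix.mulVec_smul, ← hy, Matrix.mulVec_mulVec, Matrix.mulVec_mulVec, mul_assoc Q,
      Matrix.nonsing_inv_mul_cancel_left Q _ hQ]

theorem HasKerMod.add [IsDomain D] [IsPrincipalIdealRing D] {K : Type*} [Field K] [Algebra D K]
    [IsFractionRing D K] {p : D} (hp0 : p ≠ 0) {n k j ρ r : ℕ} (hρ : ρ ≤ r)
    {A P : Matrix (Fin n) (Fin n) D} (g : (Fin n → D) →ₗ[D] (Fin ρ → K))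
    (hg : ∀ v, g v = 0 → P.mulVec v = 0) (h : HasKerMod p k j A) :
    HasKerMod p k (j - r) (A + P) := by
  obtain ⟨m, hm, w, hw, hy⟩ := h
  let f := g ∘ₗ Fintype.linearCombination D w
  have hf : ∀ c, f c = g (∑ i, c i • w i) := fun c => rfl
  have hrank : Module.rank D (Fin ρ → K) = ρ := by
    rw [← IsFractionRing.rank_right_eq D K]
    simp
  have h1 : finrank D (LinearMap.range f) ≤ ρ :=
    finrank_le_of_rank_le ((Submodule.rank_le _).trans hrank.le)
  have h2 := finrank_range_add_finrank_ker_of_isDomain f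
  rw [finrank_fin_fun] at h2
  let b := finBasis D (LinearMap.ker f)
  refine ⟨finrank D (LinearMap.ker f), by omega, fun l => ∑ i, (b l : Fin m → D) i • w i,
    fun c y hc => ?_, fun l => ?_⟩
  · have e : ∑ i, (∑ l, c l • (b l : Fin m → D)) i • w i = p • y := by
      rw [← hc]
      simp only [Finset.sum_apply, Pi.smul_apply, Finset.sum_smul, Finset.smul_sum, smul_eq_mul,
        mul_smul]
      exact Finset.sum_comm
    choose d hd using hw _ y e
    have hd' : ∑ l, c l • (b l : Fin m → D) = p • d := funext fun i => hd i
    have hdk : d ∈ LinearMap.ker f := by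
      have : p • f d = 0 := by
        rw [← map_smul, ← hd', map_sum]
        refine Finset.sum_eq_zero fun l _ => ?_
        rw [map_smul, LinearMap.mem_ker.1 (b l).2, smul_zero]
      have hinj := IsFractionRing.injective D K
      refine LinearMap.mem_ker.2 (funext fun i => ?_)
      have := congrFun this i
      rw [Pi.smul_apply, Algebra.smul_def] at this
      exact (mul_eq_zero.1 this).resolve_left ((map_ne_zero_iff _ hinj).2 hp0)
    intro l
    refine ⟨b.repr ⟨d, hdk⟩ l, ?_⟩
    have e2 : ∑ l, c l • b l = p • ⟨d, hdk⟩ := Subtype.ext (by simpa using hd')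
    have := congrArg (fun v => b.repr v l) e2
    rw [b.repr_sum_self] at this
    rw [this, map_smul]
    rfl
  · choose y hy using hy
    refine ⟨∑ i, (b l : Fin m → D) i • y i, ?_⟩
    rw [Matrix.add_mulVec, hg _ ((hf _).symm.trans (LinearMap.mem_ker.1 (b l).2)), add_zero,
      ← Matrix.mulVecLin_apply, map_sum, Finset.smul_sum]
    refine Finset.sum_congr rfl fun i _ => ?_
    rw [map_smul, Matrix.mulVecLin_apply, hy, smul_comm]
end

section
variable {R : Type*} [CommRing R] {p : R}

theorem isUnit_algebraMap_of_not_dvd {O : Type*} [CommRing O] [Algebra R O]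
    [(Ideal.span {p}).IsPrime] [IsLocalization.AtPrime O (Ideal.span {p})] {x : R} (hx : ¬p ∣ x) :
    IsUnit (algebraMap R O x) :=
  IsLocalization.map_units O (⟨x, fun h => hx (Ideal.mem_span_singleton.1 h)⟩ :
    (Ideal.span {p}).primeCompl)

theorem pow_dvd_of_algebraMap_pow_dvd [IsDomain R] {O : Type*} [CommRing O] [Algebra R O]
    [(Ideal.span {p}).IsPrime] [IsLocalization.AtPrime O (Ideal.span {p})] (hp : Prime p) {x : R}
    {k : ℕ} (h : algebraMap R O p ^ k ∣ algebraMap R O x) : p ^ k ∣ x := by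
  obtain ⟨y, hy⟩ := h
  obtain ⟨⟨a, s⟩, has⟩ := IsLocalization.surj (Ideal.span {p}).primeCompl y
  have hinj : Function.Injective (algebraMap R O) :=
    IsLocalization.injective O (Ideal.primeCompl_le_nonZeroDivisors (Ideal.span {p}))
  have : x * s = p ^ k * a := hinj (by
    rw [map_mul, map_mul, map_pow, hy, mul_assoc, has])
  have hs : ¬p ∣ (s : R) := fun h => s.2 (Ideal.mem_span_singleton.2 h)
  exact hp.pow_dvd_of_dvd_mul_right k hs ⟨a, this⟩

theorem isPrincipalIdealRing_of_isLocalization_span [IsDomain R] [WfDvdMonoid R] (O : Type*)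
    [CommRing O]
    [IsDomain O] [Algebra R O] [(Ideal.span {p}).IsPrime]
    [IsLocalization.AtPrime O (Ideal.span {p})] (hp : Prime p) (hpO : Prime (algebraMap R O p)) :
    IsPrincipalIdealRing O := by
  have : IsDiscreteValuationRing O := by
    refine IsDiscreteValuationRing.ofHasUnitMulPowIrreducibleFactorization
      ⟨_, hpO.irreducible, fun {x} hx => ?_⟩
    obtain ⟨⟨a, s⟩, has⟩ := IsLocalization.surj (Ideal.span {p}).primeCompl x
    have hs := IsLocalization.map_units O s
    have ha : a ≠ 0 := by
      rintro rfl
      rw [map_zero] at has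
      exact (mul_ne_zero hx hs.ne_zero) has
    obtain ⟨m, b, hb, rfl⟩ := WfDvdMonoid.max_power_factor ha hp.irreducible
    refine ⟨m, ?_⟩
    have hb' : IsUnit (algebraMap R O b) := isUnit_algebraMap_of_not_dvd hb
    simp only [map_mul, map_pow] at has
    have h1 : Associated (algebraMap R O p ^ m) (algebraMap R O p ^ m * algebraMap R O b) :=
      ⟨hb'.unit, rfl⟩
    have h2 : Associated x (x * algebraMap R O s) := ⟨hs.unit, rfl⟩
    rw [has] at h2
    exact h1.trans h2.symm
  infer_instance

theorem isMaximal_span_algebraMap (O : Type*) [CommRing O] [Algebra R O] [(Ideal.span {p}).IsPrime]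
    [IsLocalization.AtPrime O (Ideal.span {p})] :
    (Ideal.span {algebraMap R O p}).IsMaximal := by
  have := IsLocalization.AtPrime.isLocalRing O (Ideal.span {p})
  have h := IsLocalization.AtPrime.map_eq_maximalIdeal (Ideal.span {p}) O
  rw [Ideal.map_span, Set.image_singleton] at h
  rw [h]
  exact IsLocalRing.maximalIdeal.isMaximal O

theorem IsGCDOf.algebraMap [IsDomain R] {O : Type*} [CommRing O] [Algebra R O]
    [(Ideal.span {p}).IsPrime]
    [IsLocalization.AtPrime O (Ideal.span {p})] (hp : Prime p) {g : R} (hg0 : g ≠ 0) {S : Set R}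
    (hg : IsGCDOf g S) : IsGCDOf (algebraMap R O g) (algebraMap R O '' S) := by
  constructor
  · rintro _ ⟨x, hx, rfl⟩
    exact map_dvd _ (hg.1 x hx)
  intro d hd
  obtain ⟨x, hx, hpx⟩ : ∃ x ∈ S, ¬p * g ∣ x := by
    by_contra! h
    obtain ⟨c, hc⟩ := hg.2 _ h
    refine hp.not_isUnit (IsUnit.of_mul_eq_one c (mul_left_cancel₀ hg0 ?_))
    linear_combination -hc
  obtain ⟨y, rfl⟩ := hg.1 x hx
  have hy : ¬p ∣ y := fun ⟨z, hz⟩ => hpx ⟨z, by rw [hz]; ring⟩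
  have h := hd _ ⟨_, hx, rfl⟩
  rw [map_mul] at h
  exact (isUnit_algebraMap_of_not_dvd hy).dvd_mul_right.1 h

end

section
variable {D : Type*} [CommRing D] [UniqueFactorizationMonoid D]

theorem dvd_of_forall_prime_pow_dvd {a b : D} (ha : a ≠ 0)
    (h : ∀ p, Prime p → ∀ k, p ^ k ∣ a → p ^ k ∣ b) : a ∣ b := by
  classical
  induction a using UniqueFactorizationMonoid.induction_on_coprime with
  | h0 => exact absurd rfl ha
  | h1 hx => exact hx.dvd
  | hpr i hp => exact h _ hp _ dvd_rfl
  | hcp hxy hx hy =>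
    exact (hxy : IsRelPrime _ _).mul_dvd
      (hx (left_ne_zero_of_mul ha) fun p hp k hk => h p hp k (hk.mul_right _))
      (hy (right_ne_zero_of_mul ha) fun p hp k hk => h p hp k (hk.mul_left _))
end

end

section

open Module Polynomial

section
variable {F : Type*} [Field F]

theorem pow_mul_eval₂_div {K : Type*} [Field K] [Algebra (MvPolynomial (Fin 2) F) K]
    [FaithfulSMul (MvPolynomial (Fin 2) F) K] {p : F[X]} {d : ℕ} (hp : p.natDegree ≤ d) :
    algebraMap (MvPolynomial (Fin 2) F) K (MvPolynomial.X 1) ^ d *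
      p.eval₂ ((algebraMap (MvPolynomial (Fin 2) F) K).comp MvPolynomial.C)
        (algebraMap (MvPolynomial (Fin 2) F) K (MvPolynomial.X 0) /
          algebraMap (MvPolynomial (Fin 2) F) K (MvPolynomial.X 1)) =
      algebraMap (MvPolynomial (Fin 2) F) K (p.homogenize d) := by
  set f := algebraMap (MvPolynomial (Fin 2) F) K
  have h1 : f (MvPolynomial.X 1) ≠ 0 :=
    (map_ne_zero_iff f (FaithfulSMul.algebraMap_injective _ K)).2 (MvPolynomial.X_ne_zero _)
  refine Polynomial.induction_with_natDegree_le
    (fun p => f (MvPolynomial.X 1) ^ d * p.eval₂ (f.comp MvPolynomial.C)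
      (f (MvPolynomial.X 0) / f (MvPolynomial.X 1)) = f (p.homogenize d)) d (by simp) ?_ ?_ p hp
  · intro k c _ hk
    rw [homogenize_C_mul, homogenize_X_pow hk, eval₂_mul, eval₂_C, eval₂_X_pow, map_mul, map_mul,
      map_pow, map_pow, div_pow, ← pow_sub_mul_pow (f (MvPolynomial.X 1)) hk, RingHom.comp_apply]
    field_simp
  · intro p q _ _ hp hq
    rw [homogenize_add, map_add, ← hp, ← hq, eval₂_add, mul_add]

/-- Over a field containing `F[s, t]`, the kernel of a homogeneous pencil is cut out by as many
linear forms as its normal rank. -/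
theorem exists_ker_homPencil {K : Type*} [Field K] [Algebra (MvPolynomial (Fin 2) F) K]
    [FaithfulSMul (MvPolynomial (Fin 2) F) K] {n : ℕ} (P₀ P₁ : Matrix (Fin n) (Fin n) F) :
    ∃ E : Matrix (Fin (normalRank (pencilOf P₀ P₁))) (Fin n) K, ∀ v, E.mulVec v = 0 →
      ((homPencil P₀ P₁).map (algebraMap (MvPolynomial (Fin 2) F) K)).mulVec v = 0 := by
  let f := algebraMap (MvPolynomial (Fin 2) F) K
  have hf : Function.Injective f := FaithfulSMul.algebraMap_injective _ K
  have h1 : f (MvPolynomial.X 1) ≠ 0 := (map_ne_zero_iff f hf).2 (MvPolynomial.X_ne_zero _)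
  let σ : F[X] →+* K := eval₂RingHom (f.comp MvPolynomial.C)
    (f (MvPolynomial.X 0) / f (MvPolynomial.X 1))
  have hσ : Function.Injective σ := by
    rw [injective_iff_map_eq_zero]
    intro p hp
    have h := pow_mul_eval₂_div (K := K) (le_refl p.natDegree)
    rw [← coe_eval₂RingHom] at h
    change _ * σ p = _ at h
    rw [hp, mul_zero] at h
    have h2 := (map_eq_zero_iff f hf).1 h.symm
    rw [← dehom_homogenize (le_refl p.natDegree), h2, map_zero]
  let τ : RatFunc F →+* K := IsFractionRing.lift hσ
  have hτ : ∀ q, τ (algebraMap F[X] (RatFunc F) q) = σ q := IsFractionRing.lift_algebraMap hσ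
  obtain ⟨B, C', h⟩ : ∃ (B : Matrix (Fin n) (Fin (normalRank (pencilOf P₀ P₁))) (RatFunc F))
      (C' : Matrix (Fin (normalRank (pencilOf P₀ P₁))) (Fin n) (RatFunc F)),
      (pencilOf P₀ P₁).map (algebraMap F[X] (RatFunc F)) = B * C' := exists_rank_factorization _
  have e : (homPencil P₀ P₁).map f = f (MvPolynomial.X 1) • (B.map τ * C'.map τ) := by
    rw [← Matrix.map_mul, ← h]
    refine Matrix.ext fun i j => ?_
    simp only [homPencil, pencilOf, Matrix.map_apply, Matrix.smul_apply, Matrix.add_apply,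
      smul_eq_mul, hτ, map_add, map_mul, σ, coe_eval₂RingHom, eval₂_X, eval₂_C,
      RingHom.comp_apply]
    field_simp
  refine ⟨C'.map τ, fun v hv => ?_⟩
  change ((homPencil P₀ P₁).map f).mulVec v = 0
  rw [e, Matrix.smul_mulVec, ← Matrix.mulVec_mulVec, hv, Matrix.mulVec_zero,
    smul_zero]

theorem pow_dvd_add_of_isFractionRing {p : MvPolynomial (Fin 2) F} (hp : Prime p)
    [(Ideal.span {p}).IsPrime] (O K : Type*) [CommRing O] [IsDomain O]
    [Algebra (MvPolynomial (Fin 2) F) O] [IsLocalization.AtPrime O (Ideal.span {p})]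
    [Field K] [Algebra O K] [IsFractionRing O K] {n r : ℕ}
    {A₀ A₁ B₀ B₁ P₀ P₁ Q R : Matrix (Fin n) (Fin n) F}
    (hA : (homPencil A₀ A₁).det ≠ 0) (hB : (homPencil B₀ B₁).det ≠ 0)
    {φ ψ : ℕ → MvPolynomial (Fin 2) F}
    (hφ : IsHomogeneousIF A₀ A₁ φ) (hφc : ∀ i, i + 1 < n → φ i ∣ φ (i + 1))
    (hψ : IsHomogeneousIF B₀ B₁ ψ) (hψc : ∀ i, i + 1 < n → ψ i ∣ ψ (i + 1))
    (hQ : IsUnit Q.det) (hR : IsUnit R.det) (hP : normalRank (pencilOf P₀ P₁) ≤ r)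
    (h0 : A₀ + P₀ = Q * B₀ * R) (h1 : A₁ + P₁ = Q * B₁ * R) {i : ℕ} (hi : i + r < n) :
    ∀ k, p ^ k ∣ φ i → p ^ k ∣ ψ (i + r) := by
  have hφ0 : ∀ i < n, φ i ≠ 0 := fun i hi => ne_zero_of_dvd_ne_zero hA (dvd_det_of_isGCDOf hφ hi)
  have hψ0 : ∀ i < n, ψ i ≠ 0 := fun i hi => ne_zero_of_dvd_ne_zero hB (dvd_det_of_isGCDOf hψ hi)
  have hchain : ∀ f : ℕ → MvPolynomial (Fin 2) F, (∀ i, i + 1 < n → f i ∣ f (i + 1)) →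
      ∀ i j, i ≤ j → j < n → f i ∣ f j := by
    intro f hf i j hij
    induction j, hij using Nat.le_induction with
    | base => exact fun _ => dvd_rfl
    | succ j _ ih => exact fun hj => (ih (by omega)).trans (hf j hj)
  intro k hk
  let f := algebraMap (MvPolynomial (Fin 2) F) O
  have hinj : Function.Injective f :=
    IsLocalization.injective O (Ideal.primeCompl_le_nonZeroDivisors (Ideal.span {p}))
  have hmax : (Ideal.span {f p}).IsMaximal := isMaximal_span_algebraMap O
  have hp0 : f p ≠ 0 := (map_ne_zero_iff f hinj).2 hp.ne_zero
  have hpO : Prime (f p) := (Ideal.span_singleton_prime hp0).1 hmax.isPrime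
  have : IsPrincipalIdealRing O := isPrincipalIdealRing_of_isLocalization_span O hp hpO
  have hsmith : ∀ {G₀ G₁ : Matrix (Fin n) (Fin n) F} {α : ℕ → MvPolynomial (Fin 2) F},
      (homPencil G₀ G₁).det ≠ 0 → IsHomogeneousIF G₀ G₁ α → (∀ i < n, α i ≠ 0) →
      ∃ b c : Basis (Fin n) O (Fin n → O), ∀ i : Fin n,
        ((homPencil G₀ G₁).map f).mulVec (b i) = f (α i) • c i := by
    intro G₀ G₁ α hG hα hα0
    refine exists_smith_basis_of_isGCDOf (α := fun i => f (α i)) ?_ fun k hk => ?_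
    · have := RingHom.map_det f (homPencil G₀ G₁)
      rw [RingHom.mapMatrix_apply] at this
      rw [← this]
      exact (map_ne_zero_iff f hinj).2 hG
    · rw [← map_prod, minorsSet_map]
      exact (hα k hk).algebraMap hp (Finset.prod_ne_zero_iff.2 fun i hi =>
        hα0 i (by have := Finset.mem_range.1 hi; omega))
  obtain ⟨b, c, hbc⟩ := hsmith hA hφ hφ0
  obtain ⟨b', c', hbc'⟩ := hsmith hB hψ hψ0
  have hkA : HasKerMod (f p) k (n - i) ((homPencil A₀ A₁).map f) :=
    hasKerMod_of_pow_dvd (α := fun i => f (φ i)) hbc fun j hj hij => by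
      rw [← map_pow]
      exact map_dvd f (hk.trans (hchain φ hφc i j hij hj))
  let _ : Algebra (MvPolynomial (Fin 2) F) K := ((algebraMap O K).comp f).toAlgebra
  have : IsScalarTower (MvPolynomial (Fin 2) F) O K := .of_algebraMap_eq fun _ => rfl
  have : FaithfulSMul (MvPolynomial (Fin 2) F) K := by
    rw [faithfulSMul_iff_algebraMap_injective, IsScalarTower.algebraMap_eq _ O K]
    exact (IsFractionRing.injective O K).comp hinj
  obtain ⟨E, hE⟩ := exists_ker_homPencil (K := K) P₀ P₁
  let ι : (Fin n → O) →ₗ[O] (Fin n → K) := (Algebra.linearMap O K).compLeft (Fin n)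
  have hkAP : HasKerMod (f p) k (n - i - r)
      ((homPencil A₀ A₁).map f + (homPencil P₀ P₁).map f) := by
    refine hkA.add hp0 hP ((E.mulVecLin.restrictScalars O) ∘ₗ ι) fun v hv => ?_
    have h := hE (ι v) hv
    ext a
    apply IsFractionRing.injective O K
    refine ((?_ : _ = _).trans (congrFun h a)).trans (map_zero _).symm
    rw [Matrix.mulVec, Matrix.mulVec, dotProduct, dotProduct, map_sum]
    refine Finset.sum_congr rfl fun j _ => ?_
    rw [map_mul]
    rfl
  let γ : F →+* O := f.comp MvPolynomial.C
  have e : (homPencil A₀ A₁).map f + (homPencil P₀ P₁).map f =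
      Q.map γ * (homPencil B₀ B₁).map f * R.map γ := by
    have e1 : ∀ G₀ G₁ : Matrix (Fin n) (Fin n) F, (homPencil G₀ G₁).map f =
        f (MvPolynomial.X 1) • G₀.map γ + f (MvPolynomial.X 0) • G₁.map γ := fun G₀ G₁ =>
      Matrix.ext fun i j => by simp [homPencil, γ]
    have e2 : ∀ G H : Matrix (Fin n) (Fin n) F, (G + H).map γ = G.map γ + H.map γ := fun G H =>
      Matrix.map_add γ (map_add γ) G H
    rw [e1, e1, e1, add_add_add_comm, ← smul_add, ← smul_add, ← e2, ← e2, h0, h1]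
    simp only [Matrix.map_mul, mul_add, add_mul, Matrix.mul_smul, Matrix.smul_mul]
  have hdet : ∀ G : Matrix (Fin n) (Fin n) F, IsUnit G.det → IsUnit (G.map γ).det := fun G hG => by
    have := RingHom.map_det γ G
    rw [RingHom.mapMatrix_apply] at this
    rw [← this]
    exact hG.map γ
  rw [e, Nat.sub_sub] at hkAP
  have hkB := hkAP.mul_mul (hdet Q hQ) (hdet R hR)
  have := pow_dvd_of_hasKerMod hpO hmax hi (α := fun i => f (ψ i)) hbc'
    (fun j hj => map_dvd f (hchain ψ hψc j _ hj hi)) hkB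
  exact pow_dvd_of_algebraMap_pow_dvd hp this

theorem pow_dvd_add_of_isLocalization {p : MvPolynomial (Fin 2) F} (hp : Prime p)
    [(Ideal.span {p}).IsPrime] (O : Type*) [CommRing O] [IsDomain O]
    [Algebra (MvPolynomial (Fin 2) F) O] [IsLocalization.AtPrime O (Ideal.span {p})] {n r : ℕ}
    {A₀ A₁ B₀ B₁ P₀ P₁ Q R : Matrix (Fin n) (Fin n) F}
    (hA : (homPencil A₀ A₁).det ≠ 0) (hB : (homPencil B₀ B₁).det ≠ 0)
    {φ ψ : ℕ → MvPolynomial (Fin 2) F}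
    (hφ : IsHomogeneousIF A₀ A₁ φ) (hφc : ∀ i, i + 1 < n → φ i ∣ φ (i + 1))
    (hψ : IsHomogeneousIF B₀ B₁ ψ) (hψc : ∀ i, i + 1 < n → ψ i ∣ ψ (i + 1))
    (hQ : IsUnit Q.det) (hR : IsUnit R.det) (hP : normalRank (pencilOf P₀ P₁) ≤ r)
    (h0 : A₀ + P₀ = Q * B₀ * R) (h1 : A₁ + P₁ = Q * B₁ * R) {i : ℕ} (hi : i + r < n) :
    ∀ k, p ^ k ∣ φ i → p ^ k ∣ ψ (i + r) :=
  pow_dvd_add_of_isFractionRing hp O (FractionRing O) hA hB hφ hφc hψ hψc hQ hR hP h0 h1 hi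

theorem dvd_add_of_normalRank_le {n r : ℕ} {A₀ A₁ B₀ B₁ P₀ P₁ Q R : Matrix (Fin n) (Fin n) F}
    (hA : (homPencil A₀ A₁).det ≠ 0) (hB : (homPencil B₀ B₁).det ≠ 0)
    {φ ψ : ℕ → MvPolynomial (Fin 2) F}
    (hφ : IsHomogeneousIF A₀ A₁ φ) (hφc : ∀ i, i + 1 < n → φ i ∣ φ (i + 1))
    (hψ : IsHomogeneousIF B₀ B₁ ψ) (hψc : ∀ i, i + 1 < n → ψ i ∣ ψ (i + 1))
    (hQ : IsUnit Q.det) (hR : IsUnit R.det) (hP : normalRank (pencilOf P₀ P₁) ≤ r)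
    (h0 : A₀ + P₀ = Q * B₀ * R) (h1 : A₁ + P₁ = Q * B₁ * R) {i : ℕ} (hi : i + r < n) :
    φ i ∣ ψ (i + r) := by
  have hφ0 : φ i ≠ 0 := ne_zero_of_dvd_ne_zero hA (dvd_det_of_isGCDOf hφ (by omega))
  refine dvd_of_forall_prime_pow_dvd hφ0 fun p hp => ?_
  have : (Ideal.span {p}).IsPrime := (Ideal.span_singleton_prime hp.ne_zero).2 hp
  exact pow_dvd_add_of_isLocalization hp (Localization.AtPrime (Ideal.span {p})) hA hB hφ hφc hψ hψc
    hQ hR hP h0 h1 hi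
end

section
variable {F : Type*} [Field F]

theorem sub_pencilOf {m n : ℕ} (G₀ G₁ H₀ H₁ : Matrix (Fin m) (Fin n) F) :
    pencilOf G₀ G₁ - pencilOf H₀ H₁ = pencilOf (G₀ - H₀) (G₁ - H₁) := by
  refine Matrix.ext fun i j => ?_
  simp only [pencilOf, Matrix.sub_apply, Matrix.add_apply, Matrix.smul_apply, Matrix.map_apply,
    map_sub, smul_eq_mul]
  ring

theorem normalRank_mul_mul_le {n : ℕ} (Q G R : Matrix (Fin n) (Fin n) F[X]) :
    normalRank (Q * G * R) ≤ normalRank G := by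
  rw [normalRank, normalRank, Matrix.map_mul, Matrix.map_mul]
  exact (Matrix.rank_mul_le_left _ _).trans (Matrix.rank_mul_le_right _ _)

theorem interlace_of_dvd_add {R : Type*} [CommRing R] {n r : ℕ} {φ ψ : ℕ → R}
    (h1 : ∀ i, i + r < n → φ i ∣ ψ (i + r)) (h2 : ∀ i, i + r < n → ψ i ∣ φ (i + r)) :
    Interlace n r φ ψ := by
  intro i hi hin
  obtain ⟨i, rfl⟩ := Nat.exists_eq_add_of_le' hi
  refine ⟨?_, ?_⟩
  · rcases lt_or_ge i r with h | h
    · rw [extIF_of_lt_one _ (by omega)]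
      exact one_dvd _
    · obtain ⟨j, rfl⟩ := Nat.exists_eq_add_of_le' h
      rw [show ((j + r + 1 : ℕ) : ℤ) - r = (j : ℤ) + 1 by push_cast; ring, Nat.cast_succ,
        extIF_natCast_add_one _ (by omega), extIF_natCast_add_one _ (by omega)]
      exact h1 j (by omega)
  · rcases lt_or_ge (i + r) n with h | h
    · rw [show ((i + 1 : ℕ) : ℤ) + r = ((i + r : ℕ) : ℤ) + 1 by push_cast; ring, Nat.cast_succ,
        extIF_natCast_add_one _ (by omega), extIF_natCast_add_one _ (by omega)]
      exact h2 i h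
    · rw [extIF_of_lt φ (by push_cast; omega)]
      exact dvd_zero _

theorem interlace_of_normalRank_le {n r : ℕ} {A₀ A₁ B₀ B₁ Q R : Matrix (Fin n) (Fin n) F}
    (hA : (homPencil A₀ A₁).det ≠ 0) (hB : (homPencil B₀ B₁).det ≠ 0)
    {φ ψ : ℕ → MvPolynomial (Fin 2) F}
    (hφ : IsHomogeneousIF A₀ A₁ φ) (hφc : ∀ i, i + 1 < n → φ i ∣ φ (i + 1))
    (hψ : IsHomogeneousIF B₀ B₁ ψ) (hψc : ∀ i, i + 1 < n → ψ i ∣ ψ (i + 1))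
    (hQ : IsUnit Q.det) (hR : IsUnit R.det) {P : Matrix (Fin n) (Fin n) F[X]}
    (hP : normalRank P ≤ r)
    (h : pencilOf A₀ A₁ + P = Q.map C * pencilOf B₀ B₁ * R.map C) : Interlace n r φ ψ := by
  have hP' : P = pencilOf (Q * B₀ * R - A₀) (Q * B₁ * R - A₁) := by
    rw [← sub_pencilOf, ← mul_pencilOf_mul, ← h, add_sub_cancel_left]
  rw [hP'] at hP
  refine interlace_of_dvd_add (fun i hi => dvd_add_of_normalRank_le hA hB hφ hφc hψ hψc hQ hR hP
    (add_sub_cancel _ _) (add_sub_cancel _ _) hi) fun i hi => ?_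
  have e : ∀ X Y : Matrix (Fin n) (Fin n) F,
      X + -Q⁻¹ * (Q * X * R - Y) * R⁻¹ = Q⁻¹ * Y * R⁻¹ := fun X Y => by
    rw [mul_sub, sub_mul, neg_mul, neg_mul, neg_mul, neg_mul, sub_neg_eq_add, mul_assoc Q,
      Matrix.nonsing_inv_mul_cancel_left _ _ hQ, Matrix.mul_nonsing_inv_cancel_right _ _ hR,
      add_neg_cancel_left]
  refine dvd_add_of_normalRank_le (Q := Q⁻¹) (R := R⁻¹) hB hA hψ hψc hφ hφc
    (Matrix.isUnit_nonsing_inv_det _ hQ) (Matrix.isUnit_nonsing_inv_det _ hR) ?_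
    (e B₀ A₀) (e B₁ A₁) hi
  rw [← mul_pencilOf_mul]
  exact (normalRank_mul_mul_le _ _ _).trans hP
end

end

/-- For `n ≥ 2`, regular pencils `A(s)`, `B(s)` with homogeneous invariant
factors `φ`, `ψ`, if the partial multiplicities of `A(s)` and `B(s)` at some
`λ₀ ∈ F ∪ {∞}` coincide (expressed by the divisibility of powers of the corresponding
linear form `L = s - λ₀ t` or `L = t`), then for `0 ≤ r ≤ n` there is a pencil of normal
rank exactly `r` taking `A(s)` to `B(s)` iff the interlacing conditions hold. -/
theorem stmt16 (F : Type*) [Field F] (n : ℕ) (hn : 2 ≤ n)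
    (A₀ A₁ B₀ B₁ : Matrix (Fin n) (Fin n) F)
    (hA : (pencilOf A₀ A₁).det ≠ 0) (hB : (pencilOf B₀ B₁).det ≠ 0)
    (φ ψ : ℕ → MvPolynomial (Fin 2) F)
    (hφ : IsHomogeneousIF A₀ A₁ φ) (hφc : ∀ i, i + 1 < n → φ i ∣ φ (i + 1))
    (hψ : IsHomogeneousIF B₀ B₁ ψ) (hψc : ∀ i, i + 1 < n → ψ i ∣ ψ (i + 1))
    (L : MvPolynomial (Fin 2) F)
    (hL : (∃ lam : F, L = MvPolynomial.X 0 - MvPolynomial.C lam * MvPolynomial.X 1) ∨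
      L = MvPolynomial.X 1)
    (hmult : ∀ i < n, ∀ k : ℕ, L ^ k ∣ φ i ↔ L ^ k ∣ ψ i)
    (r : ℕ) (hr : r ≤ n) :
    (∃ P : Matrix (Fin n) (Fin n) (Polynomial F), IsPencil P ∧ normalRank P = r ∧
        StrictEquiv (pencilOf A₀ A₁ + P) (pencilOf B₀ B₁)) ↔
      Interlace n r φ ψ := by
  have hA' := (det_pencilOf_ne_zero_iff _ _).1 hA
  have hB' := (det_pencilOf_ne_zero_iff _ _).1 hB
  constructor
  · rintro ⟨P, -, hP, Q, R, hQ, hR, h⟩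
    exact interlace_of_normalRank_le hA' hB' hφ hφc hψ hψc hQ hR hP.le h
  · intro hI
    obtain ⟨Q, R, hQ, hR, h⟩ :=
      exists_normalRank_sub_le (by omega) hA' hB' hφ hφc hψ hψc hL hmult hI
    have hdet : ∀ G : Matrix (Fin n) (Fin n) F, IsUnit G.det →
        (G.map Polynomial.C).det ≠ 0 := fun G hG => by
      have := RingHom.map_det (Polynomial.C : F →+* Polynomial F) G
      rw [RingHom.mapMatrix_apply] at this
      rw [← this]
      exact (hG.map Polynomial.C).ne_zero
    obtain ⟨Q', hQ', h'⟩ := exists_normalRank_sub_eq hn hr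
      (M := Q.map Polynomial.C * pencilOf B₀ B₁ * R.map Polynomial.C) (by
        rw [Matrix.det_mul, Matrix.det_mul]
        exact mul_ne_zero (mul_ne_zero (hdet Q hQ) hB) (hdet R hR)) rfl h
    have e : Q'.map Polynomial.C * (Q.map Polynomial.C * pencilOf B₀ B₁ * R.map Polynomial.C) =
        (Q' * Q).map Polynomial.C * pencilOf B₀ B₁ * R.map Polynomial.C := by
      simp only [Matrix.map_mul, mul_assoc]
    rw [e] at h'
    refine ⟨_, ?_, h', Q' * Q, R, ?_, hR, add_sub_cancel _ _⟩
    · rw [mul_pencilOf_mul]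
      exact isPencil_sub (isPencil_pencilOf _ _) (isPencil_pencilOf _ _)
    · rw [Matrix.det_mul]
      exact hQ'.mul hQ
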